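/- arXiv:1806.04701 — 4 statements merged into one kernel-verified Lean document; each statement's English description precedes it below -/
import Mathlib

section
/- Let f : ℝ → ℝ be Lipschitz with Lipschitz constant K. Then the map ℝ^N → ℝ, x ↦ ∫ f dρ_n(x) = L^{−1} Σ_{i=1}^L f(λ_i(x)), is Lipschitz with Lipschitz constant N^{−1/2} K with respect to the Euclidean norm on ℝ^N. -/
open MeasureTheory

noncomputable section

open Matrix

/-- The entrywise squared moduli of a unitary matrix have row sums `1`. -/
lemma sum_row_normSq_of_unitary {m : Type*} [Fintype m] [DecidableEq m]
    {W : Matrix m m ℂ} (hW : W * Wᴴ = 1) (i : m) : ∑ j, Complex.normSq (W i j) = 1 := by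
  have h := congrFun (congrFun hW i) i
  simp only [Matrix.mul_apply, Matrix.conjTranspose_apply, Matrix.one_apply_eq,
    ← starRingEnd_apply, Complex.mul_conj] at h
  exact_mod_cast h

/-- The entrywise squared moduli of a unitary matrix have column sums `1`. -/
lemma sum_col_normSq_of_unitary {m : Type*} [Fintype m] [DecidableEq m]
    {W : Matrix m m ℂ} (hW : Wᴴ * W = 1) (j : m) : ∑ i, Complex.normSq (W i j) = 1 := by
  have h := sum_row_normSq_of_unitary (W := Wᴴ) (by simpa using hW) j
  simpa [Matrix.conjTranspose_apply] using h

/-- Two Hermitian matrices `X`, `Y` are coupled by a doubly stochastic array whose quadratic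
cost on the eigenvalues is `Tr (X - Y)²`. -/
lemma exists_eigenvalue_coupling {m : Type*} [Fintype m] [DecidableEq m]
    {X Y : Matrix m m ℂ} (hX : X.IsHermitian) (hY : Y.IsHermitian) :
    ∃ P : m → m → ℝ, (∀ i j, 0 ≤ P i j) ∧ (∀ i, ∑ j, P i j = 1) ∧ (∀ j, ∑ i, P i j = 1) ∧
      ((∑ i, ∑ j, P i j * (hX.eigenvalues i - hY.eigenvalues j) ^ 2 : ℝ) : ℂ) =
        ((X - Y) * (X - Y)).trace := by
  obtain ⟨U, hU⟩ : ∃ U : Matrix m m ℂ, U = hX.eigenvectorUnitary := ⟨_, rfl⟩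
  obtain ⟨V, hV⟩ : ∃ V : Matrix m m ℂ, V = hY.eigenvectorUnitary := ⟨_, rfl⟩
  have hU1 : Uᴴ * U = 1 := hU ▸ Unitary.coe_star_mul_self hX.eigenvectorUnitary
  have hU2 : U * Uᴴ = 1 := hU ▸ Unitary.coe_mul_star_self hX.eigenvectorUnitary
  have hV1 : Vᴴ * V = 1 := hV ▸ Unitary.coe_star_mul_self hY.eigenvectorUnitary
  have hV2 : V * Vᴴ = 1 := hV ▸ Unitary.coe_mul_star_self hY.eigenvectorUnitary
  have hXs : X = U * diagonal (fun i => (hX.eigenvalues i : ℂ)) * Uᴴ := by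
    conv_lhs => rw [hX.spectral_theorem]
    rw [hU]; rfl
  have hYs : Y = V * diagonal (fun i => (hY.eigenvalues i : ℂ)) * Vᴴ := by
    conv_lhs => rw [hY.spectral_theorem]
    rw [hV]; rfl
  set W := Uᴴ * V with hW
  have hWs : Wᴴ = Vᴴ * U := by simp [hW]
  have hentry : ∀ i j, (Uᴴ * (X - Y) * V) i j =
      ((hX.eigenvalues i - hY.eigenvalues j : ℝ) : ℂ) * W i j := by
    intro i j
    have h : Uᴴ * (X - Y) * V = diagonal (fun i => (hX.eigenvalues i : ℂ)) * W
        - W * diagonal (fun i => (hY.eigenvalues i : ℂ)) := by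
      have h1 : Uᴴ * X = diagonal (fun i => (hX.eigenvalues i : ℂ)) * Uᴴ := by
        conv_lhs => rw [hXs]
        rw [← Matrix.mul_assoc, ← Matrix.mul_assoc, hU1, Matrix.one_mul]
      have h2 : Y * V = V * diagonal (fun i => (hY.eigenvalues i : ℂ)) := by
        conv_lhs => rw [hYs]
        rw [Matrix.mul_assoc, hV1, Matrix.mul_one]
      rw [Matrix.mul_sub, Matrix.sub_mul, h1, Matrix.mul_assoc Uᴴ Y V, h2, hW]
      simp only [Matrix.mul_assoc]
    rw [h, Matrix.sub_apply, Matrix.diagonal_mul, Matrix.mul_diagonal]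
    push_cast
    ring
  refine ⟨fun i j => Complex.normSq (W i j), fun _ _ => Complex.normSq_nonneg _,
    sum_row_normSq_of_unitary ?_, sum_col_normSq_of_unitary ?_, ?_⟩
  · rw [hWs, hW, Matrix.mul_assoc, ← Matrix.mul_assoc V, hV2, Matrix.one_mul, hU1]
  · rw [hWs, hW, Matrix.mul_assoc, ← Matrix.mul_assoc U, hU2, Matrix.one_mul, hV1]
  · have htrace : ((Uᴴ * (X - Y) * V) * (Uᴴ * (X - Y) * V)ᴴ).trace
        = ((X - Y) * (X - Y)).trace := by
      have hD : (X - Y)ᴴ = X - Y := (hX.sub hY)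
      rw [Matrix.conjTranspose_mul, Matrix.conjTranspose_mul, hD,
        Matrix.conjTranspose_conjTranspose, Matrix.mul_assoc, ← Matrix.mul_assoc V, hV2,
        Matrix.one_mul, Matrix.mul_assoc, Matrix.trace_mul_comm, Matrix.mul_assoc,
        Matrix.mul_assoc, hU2, Matrix.mul_one]
    rw [← htrace, Matrix.trace]
    push_cast
    refine Finset.sum_congr rfl fun i _ => ?_
    rw [Matrix.diag_apply, Matrix.mul_apply]
    refine Finset.sum_congr rfl fun j _ => ?_
    rw [Matrix.conjTranspose_apply, hentry, ← starRingEnd_apply, Complex.mul_conj,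
      Complex.normSq_mul, Complex.normSq_ofReal]
    push_cast
    ring

/-- Linear eigenvalue statistics of a `K`-Lipschitz function are Lipschitz with constant
`K * √(card m)` in the Hilbert–Schmidt norm. -/
lemma abs_sum_eigenvalues_sub_le {m : Type*} [Fintype m] [DecidableEq m]
    {X Y : Matrix m m ℂ} (hX : X.IsHermitian) (hY : Y.IsHermitian)
    {f : ℝ → ℝ} {K : ℝ} (hK : 0 ≤ K) (hf : ∀ s t : ℝ, |f s - f t| ≤ K * |s - t|)
    {T : ℝ} (hT : ((X - Y) * (X - Y)).trace = (T : ℂ)) :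
    |∑ i, f (hX.eigenvalues i) - ∑ i, f (hY.eigenvalues i)|
      ≤ K * √(Fintype.card m * T) := by
  obtain ⟨P, hP, hrow, hcol, hcost⟩ := exists_eigenvalue_coupling hX hY
  have hcost : ∑ i, ∑ j, P i j * (hX.eigenvalues i - hY.eigenvalues j) ^ 2 = T := by
    exact_mod_cast hcost.trans hT
  set a := hX.eigenvalues
  set b := hY.eigenvalues
  have hdiff : ∑ i, f (a i) - ∑ j, f (b j) = ∑ i, ∑ j, P i j * (f (a i) - f (b j)) := by
    simp only [mul_sub, Finset.sum_sub_distrib]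
    rw [Finset.sum_comm (f := fun i j => P i j * f (b j))]
    simp only [← Finset.sum_mul, hrow, hcol, one_mul]
  have hlin : |∑ i, f (a i) - ∑ j, f (b j)| ≤ K * ∑ i, ∑ j, P i j * |a i - b j| := by
    rw [hdiff, Finset.mul_sum]
    refine (Finset.abs_sum_le_sum_abs _ _).trans (Finset.sum_le_sum fun i _ => ?_)
    rw [Finset.mul_sum]
    refine (Finset.abs_sum_le_sum_abs _ _).trans (Finset.sum_le_sum fun j _ => ?_)
    rw [abs_mul, abs_of_nonneg (hP i j), mul_left_comm]
    exact mul_le_mul_of_nonneg_left (hf _ _) (hP i j)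
  refine hlin.trans (mul_le_mul_of_nonneg_left (Real.le_sqrt_of_sq_le ?_) hK)
  have hcs := Finset.sum_mul_sq_le_sq_mul_sq (Finset.univ : Finset (m × m))
    (fun p => √(P p.1 p.2)) (fun p => √(P p.1 p.2) * |a p.1 - b p.2|)
  simpa only [← mul_assoc, mul_pow, Real.mul_self_sqrt (hP _ _), Real.sq_sqrt (hP _ _), sq_abs,
    Fintype.sum_prod_type, hrow, hcost, Finset.sum_const, Finset.card_univ, nsmul_eq_mul,
    mul_one] using hcs

/-- Parseval's identity for a Hilbert–Schmidt orthogonal family. -/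
lemma trace_sum_smul_mul_self {ι m : Type*} [Fintype ι] [DecidableEq ι] [Fintype m]
    {A : ι → Matrix m m ℂ} {c : ℂ}
    (htr : ∀ R R', (A R * A R').trace = if R = R' then c else 0) (z : ι → ℂ) :
    ((∑ R, z R • A R) * ∑ R, z R • A R).trace = c * ∑ R, z R ^ 2 := by
  simp only [Finset.sum_mul, Finset.mul_sum, Matrix.trace_sum, Matrix.smul_mul, Matrix.mul_smul,
    Matrix.trace_smul, htr, smul_eq_mul, mul_ite, mul_zero,
    Finset.sum_ite_eq', Finset.mem_univ, if_true]
  exact Finset.sum_congr rfl fun R _ => by ring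

theorem stmt2 {ι : Type*} [Fintype ι] [DecidableEq ι]
    (n q L N : ℕ) (hn : Even n) (hq0 : 0 < q) (hq : q ≤ n / 2)
    (hL : L = 2 ^ (n / 2)) (hN : N = n.choose q) (hcard : Fintype.card ι = N)
    (A : ι → Matrix (Fin L) (Fin L) ℂ)
    (hA : ∀ R, (A R).IsHermitian)
    (htr : ∀ R R', ((A R) * (A R')).trace = if R = R' then (L : ℂ) else 0)
    (H : EuclideanSpace ℝ ι → Matrix (Fin L) (Fin L) ℂ)
    (hH : ∀ x, H x = ((Real.sqrt N : ℂ))⁻¹ • ∑ R, (x R : ℂ) • A R)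
    (hHerm : ∀ x, (H x).IsHermitian)
    (f : ℝ → ℝ) (K : ℝ) (hK : 0 ≤ K) (hf : ∀ s t : ℝ, |f s - f t| ≤ K * |s - t|) :
    ∀ x y : EuclideanSpace ℝ ι,
      |(L : ℝ)⁻¹ * ∑ i, f ((hHerm x).eigenvalues i)
        - (L : ℝ)⁻¹ * ∑ i, f ((hHerm y).eigenvalues i)|
      ≤ (Real.sqrt N)⁻¹ * K * dist x y := by
  intro x y
  have hLpos : (0 : ℝ) < L := by rw [hL]; positivity
  have hT : ((H x - H y) * (H x - H y)).trace
      = ((L * ((√N)⁻¹ * dist x y) ^ 2 : ℝ) : ℂ) := by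
    have hdiff : H x - H y = ∑ R, ((√N : ℂ)⁻¹ * ((x R : ℂ) - y R)) • A R := by
      simp only [hH, ← Finset.sum_sub_distrib, ← sub_smul, Finset.smul_sum, smul_smul, mul_sub]
    rw [hdiff, trace_sum_smul_mul_self htr, mul_pow _ (dist x y), EuclideanSpace.dist_sq_eq]
    simp only [Real.dist_eq, sq_abs, mul_pow, ← Finset.mul_sum]
    push_cast
    ring
  have hmain := abs_sum_eigenvalues_sub_le (hHerm x) (hHerm y) hK hf hT
  have hsqrt : √((Fintype.card (Fin L) : ℝ) * (L * ((√N)⁻¹ * dist x y) ^ 2))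
      = L * ((√N)⁻¹ * dist x y) := by
    rw [Fintype.card_fin, ← mul_assoc, ← sq, ← mul_pow]
    exact Real.sqrt_sq (by positivity)
  rw [hsqrt] at hmain
  rw [← mul_sub, abs_mul, abs_of_pos (inv_pos.2 hLpos), inv_mul_le_iff₀ hLpos]
  exact hmain.trans_eq (by ring)
end
end

section
/- Let (q_n) be a sequence of integers with 0 < q_n ≤ n/2, and for each even n let x^{(n)} be a standard Gaussian random vector on ℝ^{N_n} with N_n = C(n,q_n), and let ρ_n = ρ_n(x^{(n)}) be the corresponding random empirical measure of eigenvalues of the Gaussian SYK Hamiltonian H(x^{(n)}). Let ρ_∞ be a Borel probability measure on ℝ such that d_BL(ρ_n, ρ_∞) → 0 almost surely as n → ∞ (as holds for the limiting spectral measure determined by the limit of q_n²/n). Then for every a > 0 there exists c(a) > 0 and a universal constant C > 0 such that, for all even n, P(d_BL(ρ_n, ρ_∞) > a) ≤ C e^{−c(a) C(n,q_n)}. -/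
open MeasureTheory

noncomputable section

/-- The bounded Lipschitz distance `d_BL(μ,ν) = sup |∫f dμ − ∫f dν|`, the supremum running
over all `f : ℝ → ℝ` that are 1-Lipschitz and bounded by 1. -/
def dBL (μ ν : Measure ℝ) : ℝ :=
  ⨆ f : {g : ℝ → ℝ // LipschitzWith 1 g ∧ ∀ t, |g t| ≤ 1},
    |(∫ t, f.1 t ∂μ) - ∫ t, f.1 t ∂ν|

/-- One-dimensional Brunn-Minkowski inequality for midpoints. -/
theorem volume_add_volume_le_two_mul_of_midpoint_mem {A B C : Set ℝ}
    (hA : MeasurableSet A) (hB : MeasurableSet B) (hAne : A.Nonempty) (hBne : B.Nonempty)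
    (hC : ∀ a ∈ A, ∀ b ∈ B, (a + b) / 2 ∈ C) :
    volume A + volume B ≤ 2 * volume C := by
  obtain ⟨a₀, ha₀⟩ := hAne
  obtain ⟨b₀, hb₀⟩ := hBne
  have key : ∀ K ⊆ A, IsCompact K → ∀ K' ⊆ B, IsCompact K' →
      volume K + volume K' ≤ 2 * volume C := by
    intro K hKA hK K' hKB hK'
    obtain ⟨M, hM⟩ := (hK.insert a₀).exists_isGreatest ⟨a₀, Set.mem_insert _ _⟩
    obtain ⟨m, hm⟩ := (hK'.insert b₀).exists_isLeast ⟨b₀, Set.mem_insert _ _⟩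
    have hMA : M ∈ A := Set.insert_subset ha₀ hKA hM.1
    have hmB : m ∈ B := Set.insert_subset hb₀ hKB hm.1
    have hdil : volume ((fun x : ℝ => 2 * x) '' C) = 2 * volume C := by
      simpa [← Set.image_smul] using Measure.addHaar_smul (volume : Measure ℝ) 2 C
    have hsub : (fun x => x + m) '' K ∪ (fun x => M + x) '' K' ⊆ (fun x : ℝ => 2 * x) '' C := by
      rintro z (⟨x, hx, rfl⟩ | ⟨x, hx, rfl⟩)
      · exact ⟨_, hC x (hKA hx) m hmB, by ring⟩
      · exact ⟨_, hC M hMA x (hKB hx), by ring⟩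
    have hinter : volume ((fun x => x + m) '' K ∩ (fun x => M + x) '' K') = 0 := by
      refine measure_mono_null (t := {M + m}) ?_ (by simp)
      rintro z ⟨⟨x, hx, rfl⟩, ⟨y, hy, hxy⟩⟩
      have h1 := hM.2 (Set.mem_insert_of_mem _ hx)
      have h2 := hm.2 (Set.mem_insert_of_mem _ hy)
      simp only [Set.mem_singleton_iff] at hxy ⊢
      linarith
    have hmeas : MeasurableSet ((fun x => M + x) '' K') :=
      (hK'.image (continuous_const.add continuous_id)).measurableSet
    have := measure_union_add_inter (μ := volume) ((fun x => x + m) '' K) hmeas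
    rw [hinter, add_zero] at this
    calc volume K + volume K'
        = volume ((fun x => x + m) '' K) + volume ((fun x => M + x) '' K') := by
          simp
      _ = volume ((fun x => x + m) '' K ∪ (fun x => M + x) '' K') := this.symm
      _ ≤ 2 * volume C := hdil ▸ measure_mono hsub
  rw [hA.measure_eq_iSup_isCompact, hB.measure_eq_iSup_isCompact]
  simp only [iSup_and']
  exact ENNReal.biSup_add_biSup_le' ⟨∅, Set.empty_subset _, isCompact_empty⟩
    ⟨∅, Set.empty_subset _, isCompact_empty⟩ fun K hK K' hK' => key K hK.1 hK.2 K' hK'.1 hK'.2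

/-- Additive form of the one-dimensional Prékopa-Leindler inequality, for functions with
supremum `1`. -/
theorem lintegral_add_lintegral_le_two_mul_of_midpoint {F G h : ℝ → ℝ} (hF : Measurable F)
    (hG : Measurable G) (hh : Measurable h) (hF0 : ∀ x, 0 ≤ F x) (hG0 : ∀ x, 0 ≤ G x) (hh0 : ∀ x, 0 ≤ h x)
    (hF1 : ∀ x, F x ≤ 1) (hG1 : ∀ x, G x ≤ 1)
    (hFs : ∀ t < 1, ∃ x, t < F x) (hGs : ∀ t < 1, ∃ x, t < G x)
    (hFG : ∀ x y, F x * G y ≤ h ((x + y) / 2) ^ 2) :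
    (∫⁻ x, ENNReal.ofReal (F x)) + (∫⁻ x, ENNReal.ofReal (G x)) ≤
      2 * ∫⁻ x, ENNReal.ofReal (h x) := by
  rw [lintegral_eq_lintegral_meas_lt volume (.of_forall hF0) hF.aemeasurable,
    lintegral_eq_lintegral_meas_lt volume (.of_forall hG0) hG.aemeasurable,
    lintegral_eq_lintegral_meas_lt volume (.of_forall hh0) hh.aemeasurable]
  have hmono : ∀ k : ℝ → ℝ, Measurable fun t => volume {x | t < k x} := fun k =>
    Antitone.measurable fun s t hst => measure_mono fun x hx => lt_of_le_of_lt hst hx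
  rw [← lintegral_add_left (hmono F), ← lintegral_const_mul _ (hmono h)]
  refine setLIntegral_mono' measurableSet_Ioi fun t ht => ?_
  rcases lt_or_ge t 1 with h1 | h1
  · refine volume_add_volume_le_two_mul_of_midpoint_mem (measurableSet_lt measurable_const hF)
      (measurableSet_lt measurable_const hG) (hFs t h1) (hGs t h1) fun a ha b hb => ?_
    have ht' : 0 < t := ht
    have ha' : t < F a := ha
    have hb' : t < G b := hb
    refine lt_of_pow_lt_pow_left₀ 2 (hh0 _) ((?_ : t ^ 2 < F a * G b).trans_le (hFG a b))
    nlinarith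
  · have e : ∀ k : ℝ → ℝ, (∀ x, k x ≤ 1) → {x | t < k x} = ∅ := fun k hk =>
      Set.eq_empty_of_forall_notMem fun x hx => absurd (hk x) (not_le.2 (h1.trans_lt hx))
    simp [e F hF1, e G hG1]

/-- One-dimensional Prékopa-Leindler inequality with weight `1/2`, for bounded functions. -/
theorem lintegral_mul_lintegral_le_sq_of_midpoint {F G h : ℝ → ℝ} (hF : Measurable F)
    (hG : Measurable G) (hh : Measurable h) (hF0 : ∀ x, 0 ≤ F x) (hG0 : ∀ x, 0 ≤ G x)
    (hh0 : ∀ x, 0 ≤ h x) (hFb : BddAbove (Set.range F)) (hGb : BddAbove (Set.range G))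
    (hFG : ∀ x y, F x * G y ≤ h ((x + y) / 2) ^ 2) :
    (∫⁻ x, ENNReal.ofReal (F x)) * (∫⁻ x, ENNReal.ofReal (G x)) ≤
      (∫⁻ x, ENNReal.ofReal (h x)) ^ 2 := by
  have hz : ∀ k : ℝ → ℝ, (∀ x, 0 ≤ k x) → BddAbove (Set.range k) → ¬ 0 < ⨆ x, k x →
      ∫⁻ x, ENNReal.ofReal (k x) = 0 := by
    intro k hk hb h0
    simp [fun x => ENNReal.ofReal_of_nonpos ((le_ciSup hb x).trans (not_lt.1 h0))]
  by_cases hMF : 0 < ⨆ x, F x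
  swap
  · simp [hz F hF0 hFb hMF]
  by_cases hMG : 0 < ⨆ x, G x
  swap
  · simp [hz G hG0 hGb hMG]
  set a := ⨆ x, F x
  set b := ⨆ x, G x
  have hs : 0 < √(a * b) := Real.sqrt_pos.2 (mul_pos hMF hMG)
  have hscale : ∀ (k : ℝ → ℝ) (c : ℝ), 0 < c → Measurable k →
      ∫⁻ x, ENNReal.ofReal (k x) = ENNReal.ofReal c * ∫⁻ x, ENNReal.ofReal (k x / c) := by
    intro k c hc hk
    rw [← lintegral_const_mul _ (hk.div_const c).ennreal_ofReal]
    refine lintegral_congr fun x => ?_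
    rw [← ENNReal.ofReal_mul hc.le, mul_div_cancel₀ _ hc.ne']
  have haux := lintegral_add_lintegral_le_two_mul_of_midpoint (hF.div_const a) (hG.div_const b)
    (hh.div_const √(a * b)) (fun x => div_nonneg (hF0 x) hMF.le)
    (fun x => div_nonneg (hG0 x) hMG.le)
    (fun x => div_nonneg (hh0 x) hs.le) (fun x => (div_le_one hMF).2 (le_ciSup hFb x))
    (fun x => (div_le_one hMG).2 (le_ciSup hGb x))
    (fun t ht => by
      obtain ⟨x, hx⟩ := exists_lt_of_lt_ciSup (f := F) (b := t * a) (by nlinarith)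
      exact ⟨x, (lt_div_iff₀ hMF).2 hx⟩)
    (fun t ht => by
      obtain ⟨x, hx⟩ := exists_lt_of_lt_ciSup (f := G) (b := t * b) (by nlinarith)
      exact ⟨x, (lt_div_iff₀ hMG).2 hx⟩)
    (fun x y => by
      rw [div_pow, Real.sq_sqrt (mul_pos hMF hMG).le, div_mul_div_comm]
      exact div_le_div_of_nonneg_right (hFG x y) (mul_pos hMF hMG).le)
  rw [hscale F a hMF hF, hscale G b hMG hG, hscale h _ hs hh, mul_mul_mul_comm, mul_pow,
    ← ENNReal.ofReal_mul hMF.le, ← ENNReal.ofReal_pow hs.le, Real.sq_sqrt (mul_pos hMF hMG).le]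
  gcongr
  generalize (∫⁻ x, ENNReal.ofReal (F x / a)) = u at haux ⊢
  generalize (∫⁻ x, ENNReal.ofReal (G x / b)) = v at haux ⊢
  generalize (∫⁻ x, ENNReal.ofReal (h x / √(a * b))) = w at haux ⊢
  rcases eq_or_ne w ⊤ with rfl | hw
  · simp
  have huv : u + v ≠ ⊤ := ne_top_of_le_ne_top (ENNReal.mul_ne_top (by simp) hw) haux
  lift w to NNReal using hw
  lift u to NNReal using (ENNReal.add_ne_top.1 huv).1
  lift v to NNReal using (ENNReal.add_ne_top.1 huv).2
  norm_cast at haux ⊢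
  have h' : (u : ℝ) + v ≤ 2 * w := by exact_mod_cast haux
  rw [← NNReal.coe_le_coe]
  push_cast
  nlinarith [sq_nonneg ((u : ℝ) - v), u.coe_nonneg, v.coe_nonneg, w.coe_nonneg]

open ProbabilityTheory in
/-- Property (τ) of Maurey for the standard Gaussian measure on the line. -/
theorem gaussianReal_lintegral_mul_lintegral_le {f g : ℝ → ENNReal} (hf : Measurable f)
    (hg : Measurable g) {K : ENNReal} (hK : K ≠ ⊤) (hfK : ∀ x, f x ≤ K) (hgK : ∀ x, g x ≤ K)
    (s : ℝ) (hfg : ∀ x y, f x * g y ≤ ENNReal.ofReal (Real.exp (s + (x - y) ^ 2 / 4))) :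
    (∫⁻ x, f x ∂gaussianReal 0 1) * (∫⁻ x, g x ∂gaussianReal 0 1) ≤
      ENNReal.ofReal (Real.exp s) := by
  set p : ℝ → ℝ := gaussianPDFReal 0 1 with hp
  have hp0 : ∀ x, 0 ≤ p x := gaussianPDFReal_nonneg 0 1
  have hpm : Measurable p := measurable_gaussianPDFReal 0 1
  have hpsq : ∀ x y, p x * p y * Real.exp ((x - y) ^ 2 / 4) = p ((x + y) / 2) ^ 2 := by
    intro x y
    simp only [hp, gaussianPDFReal]
    have e : Real.exp (-((x + y) / 2 - 0) ^ 2 / (2 * ((1 : NNReal) : ℝ))) ^ 2 =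
        Real.exp (-(x - 0) ^ 2 / (2 * ((1 : NNReal) : ℝ))) *
          Real.exp (-(y - 0) ^ 2 / (2 * ((1 : NNReal) : ℝ))) * Real.exp ((x - y) ^ 2 / 4) := by
      rw [← Real.exp_nat_mul, ← Real.exp_add, ← Real.exp_add]
      congr 1
      push_cast
      ring
    rw [mul_pow, e]
    ring
  have hint : ∀ k : ℝ → ENNReal, Measurable k → (∀ x, k x ≤ K) →
      ∫⁻ x, k x ∂gaussianReal 0 1 = ∫⁻ x, ENNReal.ofReal (p x * (k x).toReal) := by
    intro k hk hkK
    rw [gaussianReal_of_var_ne_zero _ one_ne_zero,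
      lintegral_withDensity_eq_lintegral_mul _ (measurable_gaussianPDF 0 1) hk]
    refine lintegral_congr fun x => ?_
    rw [ENNReal.ofReal_mul (hp0 x), ENNReal.ofReal_toReal (ne_top_of_le_ne_top hK (hkK x))]
    rfl
  have hbdd : ∀ k : ℝ → ENNReal, (∀ x, k x ≤ K) →
      BddAbove (Set.range fun x => p x * (k x).toReal) := by
    rintro k hkK
    refine ⟨(√(2 * Real.pi * (1 : NNReal)))⁻¹ * K.toReal, ?_⟩
    rintro _ ⟨x, rfl⟩
    refine mul_le_mul ?_ (ENNReal.toReal_mono hK (hkK x)) ENNReal.toReal_nonneg (by positivity)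
    rw [hp, gaussianPDFReal]
    refine mul_le_of_le_one_right (by positivity) (Real.exp_le_one_iff.2 ?_)
    exact div_nonpos_of_nonpos_of_nonneg (by nlinarith [sq_nonneg (x - 0)]) (by positivity)
  rw [hint f hf hfK, hint g hg hgK]
  have h1 : ∫⁻ x, ENNReal.ofReal (Real.exp (s / 2) * p x) = ENNReal.ofReal (Real.exp (s / 2)) := by
    simp_rw [ENNReal.ofReal_mul (Real.exp_pos (s / 2)).le]
    rw [lintegral_const_mul _ hpm.ennreal_ofReal, lintegral_gaussianPDFReal_eq_one 0 one_ne_zero,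
      mul_one]
  have h2 : ENNReal.ofReal (Real.exp s) = ENNReal.ofReal (Real.exp (s / 2)) ^ 2 := by
    rw [← ENNReal.ofReal_pow (Real.exp_pos _).le, ← Real.exp_nat_mul]
    congr 2
    push_cast
    ring
  rw [h2, ← h1]
  refine lintegral_mul_lintegral_le_sq_of_midpoint (hpm.mul hf.ennreal_toReal)
    (hpm.mul hg.ennreal_toReal) (hpm.const_mul _)
    (fun x => mul_nonneg (hp0 x) ENNReal.toReal_nonneg)
    (fun x => mul_nonneg (hp0 x) ENNReal.toReal_nonneg)
    (fun x => mul_nonneg (Real.exp_pos _).le (hp0 x)) (hbdd f hfK) (hbdd g hgK) fun x y => ?_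
  have h3 : (f x).toReal * (g y).toReal ≤ Real.exp (s + (x - y) ^ 2 / 4) := by
    rw [← ENNReal.toReal_mul]
    exact ENNReal.toReal_le_of_le_ofReal (Real.exp_pos _).le (hfg x y)
  calc p x * (f x).toReal * (p y * (g y).toReal)
      = p x * p y * ((f x).toReal * (g y).toReal) := by ring
    _ ≤ p x * p y * Real.exp (s + (x - y) ^ 2 / 4) :=
      mul_le_mul_of_nonneg_left h3 (mul_nonneg (hp0 x) (hp0 y))
    _ = (Real.exp (s / 2) * p ((x + y) / 2)) ^ 2 := by
      rw [Real.exp_add, mul_pow, ← hpsq, ← Real.exp_nat_mul]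
      push_cast
      rw [mul_div_cancel₀ s two_ne_zero]
      ring

open ProbabilityTheory in
/-- Property (τ) of Maurey for the standard Gaussian measure on `ℝ^N`. -/
theorem pi_gaussianReal_lintegral_mul_lintegral_le {K : ENNReal} (hK : K ≠ ⊤) (N : ℕ) :
    ∀ (f g : (Fin N → ℝ) → ENNReal), Measurable f → Measurable g → (∀ x, f x ≤ K) →
      (∀ x, g x ≤ K) → ∀ s : ℝ,
      (∀ x y, f x * g y ≤ ENNReal.ofReal (Real.exp (s + (∑ i, (x i - y i) ^ 2) / 4))) →
      (∫⁻ x, f x ∂Measure.pi (fun _ => gaussianReal 0 1)) *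
        (∫⁻ x, g x ∂Measure.pi (fun _ => gaussianReal 0 1)) ≤ ENNReal.ofReal (Real.exp s) := by
  induction N with
  | zero =>
    intro f g hf hg hfK hgK s hfg
    simpa [Measure.pi_of_empty (fun _ : Fin 0 => gaussianReal 0 1) 0, lintegral_dirac' _ hf,
      lintegral_dirac' _ hg] using hfg 0 0
  | succ N ih =>
    intro f g hf hg hfK hgK s hfg
    have hmp := (measurePreserving_piFinSuccAbove (fun _ : Fin (N + 1) => gaussianReal 0 1) 0).symm
    have hcons : Measurable fun z : ℝ × (Fin N → ℝ) => (Fin.cons z.1 z.2 : Fin (N + 1) → ℝ) := by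
      refine measurable_pi_lambda _ fun i => ?_
      refine Fin.cases ?_ (fun j => ?_) i
      · exact measurable_fst
      · exact (measurable_pi_apply j).comp measurable_snd
    have hint : ∀ k : (Fin (N + 1) → ℝ) → ENNReal, Measurable k →
        ∫⁻ x, k x ∂Measure.pi (fun _ => gaussianReal 0 1) =
          ∫⁻ a, ∫⁻ x, k (Fin.cons a x) ∂Measure.pi (fun _ => gaussianReal 0 1)
            ∂gaussianReal 0 1 := by
      intro k hk
      rw [← hmp.lintegral_comp hk, ← lintegral_prod (fun z => k (Fin.cons z.1 z.2))
        (hk.comp hcons).aemeasurable]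
      refine lintegral_congr fun z => congrArg k ?_
      exact Fin.insertNth_zero' z.1 z.2
    have hmeas : ∀ k : (Fin (N + 1) → ℝ) → ENNReal, Measurable k → Measurable fun a : ℝ =>
        ∫⁻ x, k (Fin.cons a x) ∂Measure.pi (fun _ : Fin N => gaussianReal 0 1) := fun k hk =>
      (hk.comp hcons).lintegral_prod_right'
    have hbd : ∀ k : (Fin (N + 1) → ℝ) → ENNReal, (∀ x, k x ≤ K) → ∀ a : ℝ,
        ∫⁻ x, k (Fin.cons a x) ∂Measure.pi (fun _ : Fin N => gaussianReal 0 1) ≤ K := by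
      intro k hk a
      refine (lintegral_mono fun x => hk _).trans ?_
      simp
    rw [hint f hf, hint g hg]
    refine gaussianReal_lintegral_mul_lintegral_le (hmeas f hf) (hmeas g hg) hK (hbd f hfK)
      (hbd g hgK) s fun a b => ?_
    refine ih _ _ (hf.comp (hcons.comp measurable_prodMk_left))
      (hg.comp (hcons.comp measurable_prodMk_left)) (fun x => hfK _) (fun x => hgK _) _
      fun x y => (hfg (Fin.cons a x) (Fin.cons b y)).trans_eq ?_
    rw [Fin.sum_univ_succ]
    simp only [Fin.cons_zero, Fin.cons_succ]
    congr 2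
    ring

open ProbabilityTheory in
/-- Gaussian concentration, in a form not referring to the mean or the median. -/
theorem pi_gaussianReal_concentration {N : ℕ} {F : (Fin N → ℝ) → ℝ} (hF : Measurable F)
    {K : ℝ} (hFK : ∀ x, |F x| ≤ K) {σ : ℝ} (hσ : 0 < σ)
    (hLip : ∀ x y, F x - F y ≤ σ * √(∑ i, (x i - y i) ^ 2)) {a b : ℝ} (hab : b ≤ a) :
    Measure.pi (fun _ => gaussianReal 0 1) {x | a < F x} *
      Measure.pi (fun _ => gaussianReal 0 1) {x | F x ≤ b} ≤
        ENNReal.ofReal (Real.exp (-(a - b) ^ 2 / (4 * σ ^ 2))) := by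
  set γ : Measure (Fin N → ℝ) := Measure.pi (fun _ => gaussianReal 0 1)
  set l : ℝ := (a - b) / (2 * σ ^ 2) with hl
  have hl0 : 0 ≤ l := div_nonneg (sub_nonneg.2 hab) (by positivity)
  have hm1 : Measurable fun x => ENNReal.ofReal (Real.exp (l * (F x - a))) := by fun_prop
  have hm2 : Measurable fun x => ENNReal.ofReal (Real.exp (l * (b - F x))) := by fun_prop
  have h1 : γ {x | a < F x} ≤ ∫⁻ x, ENNReal.ofReal (Real.exp (l * (F x - a))) ∂γ := by
    refine (measure_mono fun x hx => ?_).trans (one_mul (γ _) ▸ mul_meas_ge_le_lintegral hm1 1)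
    have hx' : a < F x := hx
    simpa using mul_nonneg hl0 (sub_nonneg.2 hx'.le)
  have h2 : γ {x | F x ≤ b} ≤ ∫⁻ x, ENNReal.ofReal (Real.exp (l * (b - F x))) ∂γ := by
    refine (measure_mono fun x hx => ?_).trans (one_mul (γ _) ▸ mul_meas_ge_le_lintegral hm2 1)
    have hx' : F x ≤ b := hx
    simpa using mul_nonneg hl0 (sub_nonneg.2 hx')
  refine (mul_le_mul' h1 h2).trans ?_
  refine pi_gaussianReal_lintegral_mul_lintegral_le
    (K := ENNReal.ofReal (Real.exp (l * (K + |a| + |b|)))) (by simp) N _ _ hm1 hm2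
    (fun x => ?_) (fun x => ?_) _ fun x y => ?_
  · gcongr
    linarith [(abs_le.1 (hFK x)).2, neg_abs_le a, abs_nonneg b]
  · gcongr
    linarith [(abs_le.1 (hFK x)).1, le_abs_self b, abs_nonneg a]
  · rw [← ENNReal.ofReal_mul (Real.exp_pos _).le, ← Real.exp_add]
    refine ENNReal.ofReal_le_ofReal (Real.exp_le_exp.2 ?_)
    set d := √(∑ i, (x i - y i) ^ 2) with hd
    have hd2 : ∑ i, (x i - y i) ^ 2 = d ^ 2 :=
      (Real.sq_sqrt (Finset.sum_nonneg fun i _ => sq_nonneg _)).symm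
    have hlσ : a - b = 2 * σ ^ 2 * l := by rw [hl]; field_simp
    have hs : -(a - b) ^ 2 / (4 * σ ^ 2) = - (σ * l) ^ 2 := by rw [hlσ]; field_simp; ring
    rw [hs, hd2]
    nlinarith [mul_le_mul_of_nonneg_left (hLip x y) hl0, sq_nonneg (d / 2 - σ * l)]

/-- The sums of a 1-Lipschitz function over the spectra of two Hermitian matrices differ by at most
the Hilbert-Schmidt distance of the matrices times the square root of the dimension. -/
theorem Matrix.IsHermitian.sum_eigenvalues_sub_le {ι : Type*} [Fintype ι] [DecidableEq ι]
    {A B : Matrix ι ι ℂ} (hA : A.IsHermitian) (hB : B.IsHermitian) {f : ℝ → ℝ}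
    (hf : LipschitzWith 1 f) :
    ∑ i, f (hA.eigenvalues i) - ∑ i, f (hB.eigenvalues i) ≤
      √(Fintype.card ι) * √((A - B) * (A - B)).trace.re := by
  set U : Matrix ι ι ℂ := (hA.eigenvectorUnitary : Matrix ι ι ℂ)
  set V : Matrix ι ι ℂ := (hB.eigenvectorUnitary : Matrix ι ι ℂ)
  have hUU : star U * U = 1 := Unitary.coe_star_mul_self _
  have hUU' : U * star U = 1 := Unitary.coe_mul_star_self _
  have hVV : star V * V = 1 := Unitary.coe_star_mul_self _
  have hVV' : V * star V = 1 := Unitary.coe_mul_star_self _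
  set S : Matrix ι ι ℂ := star U * V with hS
  have hSS : S * star S = 1 := by
    rw [hS, star_mul, star_star, Matrix.mul_assoc, ← Matrix.mul_assoc V, hVV', Matrix.one_mul, hUU]
  have hSS' : star S * S = 1 := by
    rw [hS, star_mul, star_star, Matrix.mul_assoc, ← Matrix.mul_assoc U, hUU', Matrix.one_mul, hVV]
  have hUA : star U * A = Matrix.diagonal (fun i => (hA.eigenvalues i : ℂ)) * star U := by
    have h : A = U * Matrix.diagonal (fun i => (hA.eigenvalues i : ℂ)) * star U :=
      hA.spectral_theorem
    conv_lhs => rw [h]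
    rw [← Matrix.mul_assoc, ← Matrix.mul_assoc, hUU, Matrix.one_mul]
  have hBV : B * V = V * Matrix.diagonal (fun i => (hB.eigenvalues i : ℂ)) := by
    have h : B = V * Matrix.diagonal (fun i => (hB.eigenvalues i : ℂ)) * star V :=
      hB.spectral_theorem
    conv_lhs => rw [h]
    rw [Matrix.mul_assoc, hVV, Matrix.mul_one]
  have hM : ∀ i j, (star U * (A - B) * V) i j =
      ((hA.eigenvalues i - hB.eigenvalues j : ℝ) : ℂ) * S i j := by
    intro i j
    rw [Matrix.mul_sub, Matrix.sub_mul, hUA, Matrix.mul_assoc (star U) B V, hBV,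
      Matrix.mul_assoc _ (star U) V, ← Matrix.mul_assoc (star U) V, ← hS, Matrix.sub_apply,
      Matrix.diagonal_mul, Matrix.mul_diagonal]
    push_cast
    ring
  have hrow : ∀ i, ∑ j, Complex.normSq (S i j) = 1 := by
    intro i
    have h := congrFun (congrFun hSS i) i
    simp only [Matrix.mul_apply, Matrix.star_apply, Complex.star_def, Complex.mul_conj,
      Matrix.one_apply_eq] at h
    exact_mod_cast h
  have hcol : ∀ j, ∑ i, Complex.normSq (S i j) = 1 := by
    intro j
    have h := congrFun (congrFun hSS' j) j
    simp only [Matrix.mul_apply, Matrix.star_apply, Complex.star_def,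
      ← Complex.normSq_eq_conj_mul_self, Matrix.one_apply_eq] at h
    exact_mod_cast h
  have htr : ((A - B) * (A - B)).trace.re =
      ∑ i, ∑ j, Complex.normSq (S i j) * (hA.eigenvalues i - hB.eigenvalues j) ^ 2 := by
    have h : ((A - B) * (A - B)).trace =
        ((star U * (A - B) * V) * star (star U * (A - B) * V)).trace := by
      have hD : star (A - B) = A - B := (hA.sub hB)
      rw [star_mul, star_mul, star_star, hD, Matrix.mul_assoc, ← Matrix.mul_assoc V, hVV',
        Matrix.one_mul, Matrix.mul_assoc, Matrix.trace_mul_comm (star U), Matrix.mul_assoc,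
        Matrix.mul_assoc, hUU', Matrix.mul_one]
    rw [h]
    generalize star U * (A - B) * V = M at hM
    simp only [Matrix.trace, Matrix.diag_apply, Matrix.mul_apply, Matrix.star_apply, hM,
      Complex.star_def, Complex.mul_conj, Complex.re_sum, Complex.ofReal_re, Complex.normSq_mul,
      Complex.normSq_ofReal]
    refine Finset.sum_congr rfl fun i _ => Finset.sum_congr rfl fun j _ => by ring
  have hdiff : ∑ i, f (hA.eigenvalues i) - ∑ i, f (hB.eigenvalues i) =
      ∑ i, ∑ j, Complex.normSq (S i j) * (f (hA.eigenvalues i) - f (hB.eigenvalues j)) := by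
    simp only [mul_sub, Finset.sum_sub_distrib, ← Finset.sum_mul, hrow, one_mul]
    rw [Finset.sum_comm]
    simp only [← Finset.sum_mul, hcol, one_mul]
  rw [hdiff, htr, ← Real.sqrt_mul (Nat.cast_nonneg _)]
  refine Real.le_sqrt_of_sq_le ?_
  have hcard : (Fintype.card ι : ℝ) = ∑ p : ι × ι, Complex.normSq (S p.1 p.2) := by
    rw [Fintype.sum_prod_type]
    simp [hrow]
  rw [← Fintype.sum_prod_type' (f := fun i j =>
      Complex.normSq (S i j) * (f (hA.eigenvalues i) - f (hB.eigenvalues j))),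
    ← Fintype.sum_prod_type' (f := fun i j =>
      Complex.normSq (S i j) * (hA.eigenvalues i - hB.eigenvalues j) ^ 2), hcard]
  refine Finset.sum_sq_le_sum_mul_sum_of_sq_le_mul _ (fun p _ => Complex.normSq_nonneg _)
    (fun p _ => mul_nonneg (Complex.normSq_nonneg _) (sq_nonneg _)) fun p _ => ?_
  have hfl : (f (hA.eigenvalues p.1) - f (hB.eigenvalues p.2)) ^ 2 ≤
      (hA.eigenvalues p.1 - hB.eigenvalues p.2) ^ 2 := by
    rw [sq_le_sq]
    simpa [Real.dist_eq] using hf.dist_le_mul (hA.eigenvalues p.1) (hB.eigenvalues p.2)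
  nlinarith [mul_le_mul_of_nonneg_left hfl (sq_nonneg (Complex.normSq (S p.1 p.2)))]

theorem abs_integral_sub_integral_le_two (μ ν : Measure ℝ) [IsProbabilityMeasure μ]
    [IsProbabilityMeasure ν] {f : ℝ → ℝ} (hf : ∀ t, |f t| ≤ 1) :
    |(∫ t, f t ∂μ) - ∫ t, f t ∂ν| ≤ 2 := by
  have h : ∀ κ : Measure ℝ, IsProbabilityMeasure κ → |∫ t, f t ∂κ| ≤ 1 := fun κ _ => by
    simpa using norm_integral_le_of_norm_le_const (μ := κ) (f := f) (C := 1) (.of_forall hf)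
  exact (abs_sub _ _).trans (by linarith [h μ ‹_›, h ν ‹_›])

theorem bddAbove_range_dBL (μ ν : Measure ℝ) [IsProbabilityMeasure μ] [IsProbabilityMeasure ν] :
    BddAbove (Set.range fun f : {g : ℝ → ℝ // LipschitzWith 1 g ∧ ∀ t, |g t| ≤ 1} =>
      |(∫ t, f.1 t ∂μ) - ∫ t, f.1 t ∂ν|) := by
  refine ⟨2, ?_⟩
  rintro _ ⟨f, rfl⟩
  exact abs_integral_sub_integral_le_two μ ν f.2.2

theorem dBL_nonneg (μ ν : Measure ℝ) : 0 ≤ dBL μ ν :=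
  Real.iSup_nonneg fun _ => abs_nonneg _

theorem dBL_le_two (μ ν : Measure ℝ) [IsProbabilityMeasure μ] [IsProbabilityMeasure ν] :
    dBL μ ν ≤ 2 :=
  Real.iSup_le (fun f => abs_integral_sub_integral_le_two μ ν f.2.2) zero_le_two

theorem dBL_sub_dBL_le {μ μ' ν : Measure ℝ} [IsProbabilityMeasure μ'] [IsProbabilityMeasure ν]
    {r : ℝ} (hr : 0 ≤ r)
    (h : ∀ f : ℝ → ℝ, LipschitzWith 1 f → |(∫ t, f t ∂μ) - ∫ t, f t ∂μ'| ≤ r) :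
    dBL μ ν - dBL μ' ν ≤ r := by
  rw [sub_le_iff_le_add]
  refine Real.iSup_le (fun f => ?_) (add_nonneg hr (dBL_nonneg _ _))
  exact (abs_sub_le _ (∫ t, f.1 t ∂μ') _).trans
    (add_le_add (h f.1 f.2.1) (le_ciSup (bddAbove_range_dBL μ' ν) f))

section EmpiricalSpectralMeasure

variable {k : ℕ} {A B : Matrix (Fin (2 ^ k)) (Fin (2 ^ k)) ℂ}

theorem isProbabilityMeasure_empirical_eigenvalues (hA : A.IsHermitian) :
    IsProbabilityMeasure
      ((2 ^ k : ENNReal)⁻¹ • ∑ i, Measure.dirac (hA.eigenvalues i)) := by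
  constructor
  simp [Measure.finsetSum_apply, ENNReal.inv_mul_cancel]

theorem integral_empirical_eigenvalues (hA : A.IsHermitian) {f : ℝ → ℝ} :
    ∫ t, f t ∂((2 ^ k : ENNReal)⁻¹ • ∑ i, Measure.dirac (hA.eigenvalues i)) =
      (2 ^ k : ℝ)⁻¹ * ∑ i, f (hA.eigenvalues i) := by
  rw [integral_smul_measure, integral_finsetSum_measure fun i _ => integrable_dirac (by simp)]
  simp

theorem dBL_empirical_eigenvalues_sub_le (hA : A.IsHermitian) (hB : B.IsHermitian)
    (ν : Measure ℝ) [IsProbabilityMeasure ν] :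
    dBL ((2 ^ k : ENNReal)⁻¹ • ∑ i, Measure.dirac (hA.eigenvalues i)) ν -
      dBL ((2 ^ k : ENNReal)⁻¹ • ∑ i, Measure.dirac (hB.eigenvalues i)) ν ≤
        √((2 ^ k : ℝ)⁻¹ * ((A - B) * (A - B)).trace.re) := by
  have := isProbabilityMeasure_empirical_eigenvalues hB
  refine dBL_sub_dBL_le (Real.sqrt_nonneg _) fun f hf => ?_
  have hAB := hA.sum_eigenvalues_sub_le hB hf
  have hBA := hB.sum_eigenvalues_sub_le hA hf
  rw [← neg_sub A B, neg_mul_neg] at hBA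
  rw [integral_empirical_eigenvalues, integral_empirical_eigenvalues, ← mul_sub, abs_mul,
    abs_of_pos (by positivity : (0 : ℝ) < (2 ^ k)⁻¹), inv_mul_le_iff₀ (by positivity),
    Real.sqrt_mul (by positivity), Real.sqrt_inv, ← mul_assoc, ← div_eq_mul_inv, Real.div_sqrt]
  simp only [Fintype.card_fin, Nat.cast_pow, Nat.cast_ofNat] at hAB hBA
  exact abs_sub_le_iff.2 ⟨hAB, hBA⟩

end EmpiricalSpectralMeasure

theorem trace_sq_sum_smul {ι κ : Type*} [Fintype ι] [DecidableEq ι] [Fintype κ]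
    {A : ι → Matrix κ κ ℂ} {L : ℂ}
    (htr : ∀ R R', (A R * A R').trace = if R = R' then L else 0) (z : ι → ℂ) :
    ((∑ R, z R • A R) * ∑ R, z R • A R).trace = L * ∑ R, z R ^ 2 := by
  simp only [Finset.sum_mul, Finset.mul_sum, Matrix.smul_mul, Matrix.mul_smul, Matrix.trace_sum,
    Matrix.trace_smul, htr, smul_eq_mul, mul_ite, mul_zero, Finset.mem_univ,
    if_true, Finset.sum_ite_eq']
  exact Finset.sum_congr rfl fun R _ => by ring

/-- Concentration of measure for the empirical eigenvalue measure of the Gaussian SYK model: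
if `d_BL(ρ_n, ρ_∞) → 0` almost surely along even `n`, then for every `a > 0` the probability
`P(d_BL(ρ_n, ρ_∞) > a)` is at most `C e^{−c(a)·C(n,q_n)}` with `C` universal. -/
theorem stmt4
    {Ω : Type*} [MeasurableSpace Ω] (P : Measure Ω) [IsProbabilityMeasure P]
    (q : ℕ → ℕ) (hq : ∀ n : ℕ, Even n → 0 < n → 0 < q n ∧ q n ≤ n / 2)
    (A : (n : ℕ) → Fin (n.choose (q n)) →
      Matrix (Fin (2 ^ (n / 2))) (Fin (2 ^ (n / 2))) ℂ)
    (hA : ∀ n R, (A n R).IsHermitian)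
    (htr : ∀ n R R', ((A n R) * (A n R')).trace =
      if R = R' then ((2 ^ (n / 2) : ℕ) : ℂ) else 0)
    (H : (n : ℕ) → (Fin (n.choose (q n)) → ℝ) →
      Matrix (Fin (2 ^ (n / 2))) (Fin (2 ^ (n / 2))) ℂ)
    (hH : ∀ n x, H n x = ((Real.sqrt (n.choose (q n)) : ℂ))⁻¹ • ∑ R, (x R : ℂ) • A n R)
    (hHerm : ∀ n x, (H n x).IsHermitian)
    (X : (n : ℕ) → Ω → (Fin (n.choose (q n)) → ℝ))
    (hXmeas : ∀ n, Measurable (X n))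
    (hXlaw : ∀ n, Measure.map (X n) P =
      Measure.pi (fun _ : Fin (n.choose (q n)) => ProbabilityTheory.gaussianReal 0 1))
    (ρemp : (n : ℕ) → (Fin (n.choose (q n)) → ℝ) → Measure ℝ)
    (hρ : ∀ n x, ρemp n x =
      ((2 ^ (n / 2) : ENNReal))⁻¹ • ∑ i, Measure.dirac ((hHerm n x).eigenvalues i))
    (ρinf : Measure ℝ) (hρinf : IsProbabilityMeasure ρinf)
    (has : ∀ᵐ ω ∂P, Filter.Tendsto (fun m : ℕ => dBL (ρemp (2 * m) (X (2 * m) ω)) ρinf)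
      Filter.atTop (nhds 0)) :
    ∃ C > (0 : ℝ), ∀ a > (0 : ℝ), ∃ c > (0 : ℝ), ∀ n : ℕ, Even n → 0 < n →
      (P {ω | a < dBL (ρemp n (X n ω)) ρinf}).toReal
        ≤ C * Real.exp (-c * (n.choose (q n))) := by
  have hprob : ∀ n x, IsProbabilityMeasure (ρemp n x) := fun n x => by
    rw [hρ]
    exact isProbabilityMeasure_empirical_eigenvalues (hHerm n x)
  have hLip : ∀ n x y, dBL (ρemp n x) ρinf - dBL (ρemp n y) ρinf ≤
      (√(n.choose (q n)))⁻¹ * √(∑ R, (x R - y R) ^ 2) := by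
    intro n x y
    have hD : H n x - H n y =
        ((√(n.choose (q n)) : ℂ))⁻¹ • ∑ R, ((x R - y R : ℝ) : ℂ) • A n R := by
      rw [hH, hH, ← smul_sub, ← Finset.sum_sub_distrib]
      simp only [Complex.ofReal_sub, sub_smul]
    have htrace : ((H n x - H n y) * (H n x - H n y)).trace.re =
        (n.choose (q n) : ℝ)⁻¹ * (2 ^ (n / 2) * ∑ R, (x R - y R) ^ 2) := by
      have hsq : ((√(n.choose (q n)) : ℂ))⁻¹ * ((√(n.choose (q n)) : ℂ))⁻¹ =
          (((n.choose (q n) : ℝ)⁻¹ : ℝ) : ℂ) := by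
        rw [← mul_inv, ← Complex.ofReal_mul, Real.mul_self_sqrt (Nat.cast_nonneg _),
          Complex.ofReal_inv]
      rw [hD, Matrix.smul_mul, Matrix.mul_smul, smul_smul, hsq, Matrix.trace_smul,
        trace_sq_sum_smul (htr n)]
      rw [← Complex.ofReal_re ((n.choose (q n) : ℝ)⁻¹ * (2 ^ (n / 2) * ∑ R, (x R - y R) ^ 2))]
      congr 1
      push_cast
      rfl
    have h := dBL_empirical_eigenvalues_sub_le (hHerm n x) (hHerm n y) ρinf
    rw [htrace, mul_left_comm, inv_mul_cancel_left₀ (by positivity), Real.sqrt_mul (by positivity),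
      Real.sqrt_inv] at h
    rwa [hρ, hρ]
  have hcont : ∀ n, Continuous fun x => dBL (ρemp n x) ρinf := by
    intro n
    refine continuous_iff_continuousAt.2 fun y => ?_
    refine tendsto_iff_dist_tendsto_zero.2 (squeeze_zero (fun _ => dist_nonneg)
      (g := fun x => (√(n.choose (q n)))⁻¹ * √(∑ R, (x R - y R) ^ 2)) (fun x => ?_) ?_)
    · rw [Real.dist_eq]
      refine abs_sub_le_iff.2 ⟨hLip n x y, (hLip n y x).trans_eq ?_⟩
      simp only [sub_sq_comm]
    · have hc : Continuous fun x : Fin (n.choose (q n)) → ℝ =>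
          (√(n.choose (q n)))⁻¹ * √(∑ R, (x R - y R) ^ 2) := by fun_prop
      simpa using hc.tendsto y
  have hmeas : ∀ n, Measurable fun x => dBL (ρemp n x) ρinf := fun n => (hcont n).measurable
  have hconv := tendstoInMeasure_of_tendsto_ae (μ := P)
    (f := fun m ω => dBL (ρemp (2 * m) (X (2 * m) ω)) ρinf) (g := fun _ => 0)
    (fun m => ((hmeas _).comp (hXmeas _)).aestronglyMeasurable) has
  refine ⟨2, two_pos, fun a ha => ?_⟩
  have hev := (hconv (ENNReal.ofReal (a / 2)) (by simpa using ha)).eventually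
    (gt_mem_nhds (show (0 : ENNReal) < 2⁻¹ by simp))
  obtain ⟨m₀, hm₀⟩ := Filter.eventually_atTop.1 hev
  set T : ℝ := 1 + ∑ n ∈ Finset.range (2 * m₀), (n.choose (q n) : ℝ) with hT
  have hT0 : 0 < T := add_pos_of_pos_of_nonneg one_pos (Finset.sum_nonneg fun _ _ => by positivity)
  refine ⟨min (a ^ 2 / 16) (Real.log 2 / T),
    lt_min (by positivity) (div_pos (Real.log_pos one_lt_two) hT0), fun n hn hn0 => ?_⟩
  set N : ℕ := n.choose (q n) with hN
  have hNpos : 0 < N := Nat.choose_pos ((hq n hn hn0).2.trans (Nat.div_le_self _ _))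
  rcases lt_or_ge n (2 * m₀) with hlt | hge
  · have hNT : (N : ℝ) ≤ T := by
      have := Finset.single_le_sum (f := fun n => (n.choose (q n) : ℝ))
        (fun _ _ => by positivity) (Finset.mem_range.2 hlt)
      linarith
    have hc : min (a ^ 2 / 16) (Real.log 2 / T) * N ≤ Real.log 2 := by
      calc _ ≤ Real.log 2 / T * T := by
            gcongr
            exacts [min_le_right _ _]
        _ = Real.log 2 := div_mul_cancel₀ _ hT0.ne'
    have hexp : (2 : ℝ)⁻¹ ≤ Real.exp (-min (a ^ 2 / 16) (Real.log 2 / T) * N) := by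
      rw [← Real.exp_log (show (0 : ℝ) < 2⁻¹ by norm_num), Real.log_inv]
      exact Real.exp_le_exp.2 (by linarith)
    have hP : (P {ω | a < dBL (ρemp n (X n ω)) ρinf}).toReal ≤ 1 := measureReal_le_one
    linarith
  · obtain ⟨m, rfl⟩ := hn.two_dvd
    have hm := hm₀ m (by omega)
    have hpre : ∀ s : Set (Fin ((2 * m).choose (q (2 * m))) → ℝ), MeasurableSet s →
        Measure.pi (fun _ => ProbabilityTheory.gaussianReal 0 1) s = P (X (2 * m) ⁻¹' s) := by
      intro s hs
      rw [← hXlaw, Measure.map_apply (hXmeas _) hs]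
    have hhalf : 2⁻¹ ≤ P {ω | dBL (ρemp (2 * m) (X (2 * m) ω)) ρinf ≤ a / 2} := by
      have hset : MeasurableSet {ω | dBL (ρemp (2 * m) (X (2 * m) ω)) ρinf ≤ a / 2} :=
        measurableSet_le ((hmeas _).comp (hXmeas _)) measurable_const
      have hcompl : P {ω | dBL (ρemp (2 * m) (X (2 * m) ω)) ρinf ≤ a / 2}ᶜ ≤ 2⁻¹ := by
        refine (measure_mono fun ω hω => ?_).trans hm.le
        have hω' : a / 2 < dBL (ρemp (2 * m) (X (2 * m) ω)) ρinf := not_le.1 hω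
        rw [Set.mem_ofPred_eq, edist_dist, Real.dist_eq, sub_zero]
        exact ENNReal.ofReal_le_ofReal (hω'.le.trans (le_abs_self _))
      have htot := measure_add_measure_compl (μ := P) hset
      rw [measure_univ] at htot
      rw [← ENNReal.add_le_add_iff_right (a := 2⁻¹) (by simp), ENNReal.inv_two_add_inv_two, ← htot]
      gcongr
    have hσ : 0 < (√(N : ℝ))⁻¹ := by positivity
    have hconc := pi_gaussianReal_concentration (hmeas (2 * m)) (K := 2)
      (fun x => (abs_of_nonneg (dBL_nonneg _ _)).trans_le
        (have := hprob (2 * m) x; dBL_le_two _ _)) hσ (hLip (2 * m)) (half_le_self ha.le)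
    rw [hpre _ (measurableSet_lt measurable_const (hmeas _)),
      hpre _ (measurableSet_le (hmeas _) measurable_const)] at hconc
    have hle := (mul_le_mul_right hhalf _).trans hconc
    have hreal := ENNReal.toReal_mono ENNReal.ofReal_ne_top hle
    rw [ENNReal.toReal_mul, ENNReal.toReal_ofReal (Real.exp_pos _).le, inv_pow,
      Real.sq_sqrt (Nat.cast_nonneg _)] at hreal
    have hexp : Real.exp (-(a - a / 2) ^ 2 / (4 * (N : ℝ)⁻¹)) ≤
        Real.exp (-min (a ^ 2 / 16) (Real.log 2 / T) * N) := by
      refine Real.exp_le_exp.2 ?_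
      have h1 : -(a - a / 2) ^ 2 / (4 * (N : ℝ)⁻¹) = -(a ^ 2 / 16 * N) := by
        field_simp
        ring
      rw [h1, neg_mul, neg_le_neg_iff]
      exact mul_le_mul_of_nonneg_right (min_le_left _ _) (Nat.cast_nonneg _)
    have h2 : ((2 : ENNReal)⁻¹).toReal = 2⁻¹ := by simp
    rw [h2] at hreal
    change (P {ω | a < dBL (ρemp (2 * m) (X (2 * m) ω)) ρinf}).toReal * 2⁻¹ ≤ _ at hreal
    linarith
end
end

section
/- Let n be a positive even integer, let k be an integer with 0 ≤ k ≤ n/2, and let a, b < 1/2. Then ∫_{Σ_n} |Δ(μ)|² exp(a Σ_{j=1}^k μ_j² + b Σ_{j=k+1}^{n/2} μ_j² − Σ_{j=1}^{n/2} μ_j²/2) dμ ≤ Z_n · 2^{nk} (1−2a)^{−k(n−k−1/2)} (1−2b)^{−(n/2−k)((n−1)/2−k)}. -/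
open MeasureTheory

noncomputable section

/-- The open Weyl chamber `Σ_n`: strictly decreasing positive vectors. -/
def SigmaN (m : ℕ) : Set (Fin m → ℝ) :=
  {μ | (∀ i j : Fin m, i < j → μ j < μ i) ∧ ∀ i, 0 < μ i}

/-- The Vandermonde-type determinant `Δ(μ) = ∏_{i<j} (μ_i² − μ_j²)`. -/
def VdM (m : ℕ) (μ : Fin m → ℝ) : ℝ :=
  ∏ p ∈ Finset.univ.filter (fun p : Fin m × Fin m => p.1 < p.2), (μ p.1 ^ 2 - μ p.2 ^ 2)

/-- The normalization constant `Z_n = (π/2)^{n/4} ∏_{j=0}^{n/2−1} (2j)!`. -/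
def Zn (n : ℕ) : ℝ :=
  (Real.pi / 2) ^ ((n : ℝ) / 4) * ∏ j ∈ Finset.range (n / 2), (Nat.factorial (2 * j) : ℝ)

open Matrix in
/-- **Andréief's identity**, together with the integrability of the squared determinant. -/
theorem integrable_and_integral_det_sq {N : ℕ} (ν : Measure ℝ) [SigmaFinite ν]
    (f : Fin N → ℝ → ℝ) (hf : ∀ i j, Integrable (fun x => f i x * f j x) ν) :
    Integrable (fun x : Fin N → ℝ => (of fun i j => f i (x j)).det ^ 2) (Measure.pi fun _ => ν) ∧
    ∫ x : Fin N → ℝ, (of fun i j => f i (x j)).det ^ 2 ∂(Measure.pi fun _ => ν) =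
      N.factorial * (of fun i j => ∫ x, f i x * f j x ∂ν).det := by
  have expand : (fun x : Fin N → ℝ => (of fun i j => f i (x j)).det ^ 2) =
      fun x => ∑ σ : Equiv.Perm (Fin N), ∑ τ : Equiv.Perm (Fin N),
        ((σ.sign : ℤ) : ℝ) * ((τ.sign : ℤ) : ℝ) * ∏ i, (f (σ i) (x i) * f (τ i) (x i)) := by
    funext x
    rw [sq, det_apply', Finset.sum_mul_sum]
    refine Finset.sum_congr rfl fun σ _ => Finset.sum_congr rfl fun τ _ => ?_
    simp only [of_apply, Finset.prod_mul_distrib]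
    ring
  have hint (σ τ : Equiv.Perm (Fin N)) :
      Integrable (fun x : Fin N → ℝ => ((σ.sign : ℤ) : ℝ) * ((τ.sign : ℤ) : ℝ) *
        ∏ i, (f (σ i) (x i) * f (τ i) (x i))) (Measure.pi fun _ => ν) :=
    (Integrable.fintype_prod (f := fun i y => f (σ i) y * f (τ i) y)
      fun i => hf (σ i) (τ i)).const_mul _
  rw [expand]
  refine ⟨integrable_finsetSum _ fun σ _ => integrable_finsetSum _ fun τ _ => hint σ τ, ?_⟩
  rw [integral_finsetSum _ fun σ _ => integrable_finsetSum _ fun τ _ => hint σ τ]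
  set G : Matrix (Fin N) (Fin N) ℝ := of fun i j => ∫ x, f i x * f j x ∂ν with hG
  have inner (σ : Equiv.Perm (Fin N)) :
      ∫ x : Fin N → ℝ, ∑ τ : Equiv.Perm (Fin N), ((σ.sign : ℤ) : ℝ) * ((τ.sign : ℤ) : ℝ) *
        ∏ i, (f (σ i) (x i) * f (τ i) (x i)) ∂(Measure.pi fun _ => ν) = G.det := by
    rw [integral_finsetSum _ fun τ _ => hint σ τ]
    have hperm := det_permute σ G
    have hsq : ((σ.sign : ℤ) : ℝ) * ((σ.sign : ℤ) : ℝ) = 1 := by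
      rcases Int.units_eq_one_or σ.sign with h | h <;> simp [h]
    have hdet : G.det = ((σ.sign : ℤ) : ℝ) * (G.submatrix σ id).det := by
      rw [hperm, ← mul_assoc, hsq, one_mul]
    rw [hdet, ← det_transpose, det_apply', Finset.mul_sum]
    refine Finset.sum_congr rfl fun τ _ => ?_
    rw [integral_const_mul,
      integral_fintype_prod_eq_prod (fun i y => f (σ i) y * f (τ i) y)]
    simp [hG, mul_assoc]
  simp [inner, Fintype.card_perm]

theorem Gamma_add_nat_eq_mul_ascPochhammer {z : ℝ} (hz : 0 < z) (j : ℕ) :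
    Real.Gamma (z + j) = Real.Gamma z * (ascPochhammer ℝ j).eval z := by
  induction j with
  | zero => simp
  | succ j ih =>
    rw [ascPochhammer_succ_eval, ← mul_assoc, ← ih]
    push_cast
    rw [← add_assoc, Real.Gamma_add_one (by positivity), mul_comm]

open Matrix in
theorem det_Gamma_hankel (N : ℕ) {z : ℝ} (hz : 0 < z) :
    (of fun i j : Fin N => Real.Gamma (z + i + j)).det =
      ∏ i ∈ Finset.range N, ((i.factorial : ℝ) * Real.Gamma (z + i)) := by
  have h1 : (of fun i j : Fin N => Real.Gamma (z + i + j)) =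
      of fun i j : Fin N => Real.Gamma (z + i) *
        (of fun i j : Fin N => (ascPochhammer ℝ j).eval (z + i)) i j := by
    ext i j
    simp only [of_apply]
    exact Gamma_add_nat_eq_mul_ascPochhammer (by positivity) j
  have h2 : (of fun i j : Fin N => (ascPochhammer ℝ j).eval (z + i)).det =
      ∏ i ∈ Finset.range N, (i.factorial : ℝ) := by
    rw [← det_eval_matrixOfPolynomials_eq_det_vandermonde (fun i : Fin N => z + (i : ℝ))
      (fun j => ascPochhammer ℝ j) (fun j => ascPochhammer_natDegree _ _)
      (fun j => monic_ascPochhammer ℝ _)]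
    have h3 : (vandermonde fun i : Fin N => z + (i : ℝ)).det =
        (vandermonde fun i : Fin N => (i : ℝ)).det := by
      simp [det_vandermonde]
    rw [h3]
    cases N with
    | zero => simp
    | succ N =>
      rw [det_vandermonde_id_eq_superFactorial, ← Nat.prod_range_succ_factorial, Nat.cast_prod]
  rw [h1, det_mul_column, h2, Finset.prod_mul_distrib, mul_comm,
    Fin.prod_univ_eq_prod_range (fun i => Real.Gamma (z + i))]

theorem Gamma_nat_add_half_mul (j : ℕ) :
    Real.Gamma (j + 1 / 2) * (4 ^ j * j.factorial) = (2 * j).factorial * √Real.pi := by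
  induction j with
  | zero => simpa using Real.Gamma_one_half_eq
  | succ j ih =>
    have h : ((j + 1 : ℕ) : ℝ) + 1 / 2 = (j + 1 / 2 : ℝ) + 1 := by push_cast; ring
    rw [h, Real.Gamma_add_one (by positivity), show 2 * (j + 1) = 2 * j + 1 + 1 by ring,
      Nat.factorial_succ, Nat.factorial_succ, Nat.factorial_succ]
    push_cast
    linear_combination (2 * (j : ℝ) + 1) * (2 * j + 2) * ih

/-- Even Gaussian moments on the half line. -/
theorem integrable_and_integral_even_moment {β : ℝ} (hβ : 0 < β) (r : ℕ) :
    Integrable (fun x : ℝ => x ^ (2 * r) * Real.exp (-β * x ^ 2)) (volume.restrict (Set.Ioi 0)) ∧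
    ∫ x in Set.Ioi (0 : ℝ), x ^ (2 * r) * Real.exp (-β * x ^ 2) =
      β ^ (-(r + 1 / 2 : ℝ)) * (1 / 2) * Real.Gamma (r + 1 / 2) := by
  have hr : (-1 : ℝ) < (2 * r : ℕ) := by linarith [Nat.cast_nonneg (α := ℝ) (2 * r)]
  constructor
  · have := integrableOn_rpow_mul_exp_neg_mul_sq hβ hr
    simpa only [IntegrableOn, Real.rpow_natCast] using this
  · have := integral_rpow_mul_exp_neg_mul_rpow (p := 2) two_pos hr hβ
    have h2 : ((2 * r : ℕ) + 1 : ℝ) / 2 = r + 1 / 2 := by push_cast; ring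
    rw [neg_div, h2] at this
    rw [← this]
    norm_cast

/-- The unnormalized density of the Laguerre-type ensemble obtained from `VdM` and the weight
`x ^ (2 * c) * exp (-β * x ^ 2)`. -/
def laguerreDensity (N c : ℕ) (β : ℝ) (x : Fin N → ℝ) : ℝ :=
  VdM N x ^ 2 * ∏ i, (x i ^ (2 * c) * Real.exp (-β * x i ^ 2))

/-- The value of the `i`-th Laguerre norm for the weight `x ^ (2 * c) * exp (-β * x ^ 2)` on the
half line. -/
def laguerreNorm (c : ℕ) (β : ℝ) (i : ℕ) : ℝ :=
  i.factorial * Real.Gamma (c + 1 / 2 + i) * (β ^ (-(c + 1 / 2 + 2 * i : ℝ)) * (1 / 2))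

theorem VdM_eq_prod_prod (m : ℕ) (x : Fin m → ℝ) :
    VdM m x = ∏ i, ∏ j ∈ Finset.Ioi i, (x i ^ 2 - x j ^ 2) := by
  rw [VdM, Finset.prod_filter, Fintype.prod_prod_type]
  refine Finset.prod_congr rfl fun i _ => ?_
  rw [← Finset.prod_filter]
  congr 1
  ext j
  simp

theorem VdM_sq_eq_det_vandermonde_sq (m : ℕ) (x : Fin m → ℝ) :
    VdM m x ^ 2 = (Matrix.vandermonde fun i => x i ^ 2).det ^ 2 := by
  rw [VdM_eq_prod_prod, Matrix.det_vandermonde]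
  simp only [← Finset.prod_pow]
  exact Finset.prod_congr rfl fun i _ => Finset.prod_congr rfl fun j _ => by ring

open Matrix in
theorem laguerreDensity_eq_det_sq (N c : ℕ) (β : ℝ) (x : Fin N → ℝ) :
    laguerreDensity N c β x = (of fun i j : Fin N =>
      x j ^ (c + 2 * (i : ℕ)) * Real.exp (-(β / 2) * x j ^ 2)).det ^ 2 := by
  have h : (of fun i j : Fin N => x j ^ (c + 2 * (i : ℕ)) * Real.exp (-(β / 2) * x j ^ 2)) =
      of fun i j : Fin N => (x j ^ c * Real.exp (-(β / 2) * x j ^ 2)) *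
        (vandermonde fun i => x i ^ 2)ᵀ i j := by
    ext i j
    simp only [of_apply, transpose_apply, vandermonde_apply]
    ring
  rw [h, det_mul_row, det_transpose, mul_pow, ← VdM_sq_eq_det_vandermonde_sq, laguerreDensity,
    mul_comm, ← Finset.prod_pow]
  congr 1
  refine Finset.prod_congr rfl fun i _ => ?_
  rw [mul_pow, ← pow_mul, ← Real.exp_nat_mul, mul_comm c 2]
  congr 2
  push_cast
  ring

theorem laguerreDensity_nonneg (N c : ℕ) (β : ℝ) (x : Fin N → ℝ) :
    0 ≤ laguerreDensity N c β x := by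
  rw [laguerreDensity_eq_det_sq]
  positivity

open Matrix in
theorem laguerreDensity_comp_perm (N c : ℕ) (β : ℝ) (σ : Equiv.Perm (Fin N)) (x : Fin N → ℝ) :
    laguerreDensity N c β (x ∘ σ) = laguerreDensity N c β x := by
  rw [laguerreDensity_eq_det_sq, laguerreDensity_eq_det_sq]
  have h := det_permute' σ (of fun i j : Fin N =>
      x j ^ (c + 2 * (i : ℕ)) * Real.exp (-(β / 2) * x j ^ 2))
  have hsq : ((σ.sign : ℤ) : ℝ) ^ 2 = 1 := by
    rcases Int.units_eq_one_or σ.sign with h | h <;> simp [h]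
  calc _ = (((σ.sign : ℤ) : ℝ) * (of fun i j : Fin N =>
      x j ^ (c + 2 * (i : ℕ)) * Real.exp (-(β / 2) * x j ^ 2)).det) ^ 2 := by rw [← h]; rfl
    _ = _ := by rw [mul_pow, hsq, one_mul]

open Matrix in
/-- The Selberg integral for the Laguerre weight on the positive orthant. -/
theorem integrable_and_integral_laguerreDensity (N c : ℕ) {β : ℝ} (hβ : 0 < β) :
    IntegrableOn (laguerreDensity N c β) (Set.univ.pi fun _ => Set.Ioi 0) ∧
    ∫ x in Set.univ.pi fun _ => Set.Ioi 0, laguerreDensity N c β x =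
      N.factorial * ∏ i ∈ Finset.range N, laguerreNorm c β i := by
  have hmul (i j : Fin N) (x : ℝ) :
      (x ^ (c + 2 * (i : ℕ)) * Real.exp (-(β / 2) * x ^ 2)) *
        (x ^ (c + 2 * (j : ℕ)) * Real.exp (-(β / 2) * x ^ 2)) =
      x ^ (2 * (c + i + j)) * Real.exp (-β * x ^ 2) := by
    rw [mul_mul_mul_comm, ← pow_add, ← Real.exp_add]
    congr 2 <;> ring
  have key := integrable_and_integral_det_sq (N := N) (volume.restrict (Set.Ioi (0 : ℝ)))
    (fun i x => x ^ (c + 2 * (i : ℕ)) * Real.exp (-(β / 2) * x ^ 2)) (fun i j => by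
      simp only [hmul]
      exact (integrable_and_integral_even_moment hβ _).1)
  rw [← Measure.restrict_pi_pi, ← volume_pi] at key
  have hfun : laguerreDensity N c β = fun x => (of fun i j : Fin N =>
      x j ^ (c + 2 * (i : ℕ)) * Real.exp (-(β / 2) * x j ^ 2)).det ^ 2 :=
    funext (laguerreDensity_eq_det_sq N c β)
  rw [hfun]
  refine ⟨key.1, key.2.trans ?_⟩
  congr 1
  have hentry : (of fun i j : Fin N => ∫ x in Set.Ioi (0 : ℝ),
        (x ^ (c + 2 * (i : ℕ)) * Real.exp (-(β / 2) * x ^ 2)) *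
        (x ^ (c + 2 * (j : ℕ)) * Real.exp (-(β / 2) * x ^ 2))) =
      of fun i j : Fin N => β ^ (-(j : ℝ)) * (of fun i j : Fin N =>
        (β ^ (-(c + 1 / 2 + i : ℝ)) * (1 / 2)) *
          (of fun i j : Fin N => Real.Gamma ((c + 1 / 2 : ℝ) + i + j)) i j) i j := by
    ext i j
    simp only [of_apply, hmul]
    rw [(integrable_and_integral_even_moment hβ _).2, ← mul_assoc, ← mul_assoc,
      ← Real.rpow_add hβ]
    push_cast
    congr 2 <;> ring_nf
  rw [hentry, det_mul_row, det_mul_column, det_Gamma_hankel N (by positivity),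
    Fin.prod_univ_eq_prod_range (fun i => β ^ (-(i : ℝ))),
    Fin.prod_univ_eq_prod_range (fun i => β ^ (-(c + 1 / 2 + i : ℝ)) * (1 / 2)),
    ← Finset.prod_mul_distrib, ← Finset.prod_mul_distrib]
  refine Finset.prod_congr rfl fun i _ => ?_
  rw [laguerreNorm, show (-(c + 1 / 2 + 2 * i : ℝ)) = -(i : ℝ) + -(c + 1 / 2 + i) by ring,
    Real.rpow_add hβ]
  ring

theorem measurableSet_SigmaN (m : ℕ) : MeasurableSet (SigmaN m) := by
  have h : SigmaN m = (⋂ i, ⋂ j, ⋂ (_ : i < j), {x : Fin m → ℝ | x j < x i}) ∩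
      ⋂ i, {x : Fin m → ℝ | 0 < x i} := by
    ext x
    simp [SigmaN]
  rw [h]
  refine MeasurableSet.inter ?_ ?_
  · exact .iInter fun i => .iInter fun j => .iInter fun _ =>
      measurableSet_lt (measurable_pi_apply _) (measurable_pi_apply _)
  · exact .iInter fun i => measurableSet_lt measurable_const (measurable_pi_apply _)

theorem SigmaN_subset_pi (m : ℕ) : SigmaN m ⊆ Set.univ.pi fun _ => Set.Ioi 0 :=
  fun _ hx i _ => hx.2 i

/-- At most one rearrangement of a vector lies in the Weyl chamber. -/
theorem perm_eq_of_comp_mem_SigmaN {m : ℕ} {x : Fin m → ℝ} {σ τ : Equiv.Perm (Fin m)}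
    (hσ : x ∘ σ ∈ SigmaN m) (hτ : x ∘ τ ∈ SigmaN m) : σ = τ := by
  have hs : StrictAnti (x ∘ σ) := fun i j h => hσ.1 i j h
  have ht : StrictAnti (x ∘ τ) := fun i j h => hτ.1 i j h
  have hmono : StrictMono (τ⁻¹ * σ : Equiv.Perm (Fin m)) := by
    intro i j hij
    rw [← ht.lt_iff_gt]
    simpa using hs hij
  have hid : (τ⁻¹ * σ : Equiv.Perm (Fin m)) = 1 := by
    ext i
    have := congrFun (hmono.range_inj strictMono_id |>.1 (by
      simp [Set.range_eq_univ.2 (Equiv.surjective _)])) i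
    simpa using congrArg Fin.val this
  exact (inv_mul_eq_one.1 hid).symm

theorem factorial_mul_setIntegral_SigmaN_le {m : ℕ} {f : (Fin m → ℝ) → ℝ} (hf0 : ∀ x, 0 ≤ f x)
    (hsymm : ∀ (σ : Equiv.Perm (Fin m)) x, f (x ∘ σ) = f x)
    (hf : IntegrableOn f (Set.univ.pi fun _ => Set.Ioi 0)) :
    m.factorial * ∫ x in SigmaN m, f x ≤ ∫ x in Set.univ.pi fun _ => Set.Ioi 0, f x := by
  let S (σ : Equiv.Perm (Fin m)) : Set (Fin m → ℝ) := (fun x => x ∘ σ) ⁻¹' SigmaN m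
  have hSm (σ) : MeasurableSet (S σ) :=
    (measurable_pi_lambda _ fun i => measurable_pi_apply (σ i)) (measurableSet_SigmaN m)
  have hSsub (σ) : S σ ⊆ Set.univ.pi fun _ => Set.Ioi 0 := by
    intro x hx i _
    simpa using hx.2 (σ⁻¹ i)
  have hSint (σ) : ∫ x in S σ, f x = ∫ x in SigmaN m, f x := by
    have hmp := volume_measurePreserving_piCongrLeft (fun _ : Fin m => ℝ) σ⁻¹
    have hcomp : ⇑(MeasurableEquiv.piCongrLeft (fun _ : Fin m => ℝ) σ⁻¹) = fun x => x ∘ σ := by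
      funext x i
      have := MeasurableEquiv.piCongrLeft_apply_apply (σ⁻¹ : Equiv.Perm (Fin m))
        (β := fun _ => ℝ) x (σ i)
      simpa using this
    have := hmp.setIntegral_preimage_emb
      (MeasurableEquiv.piCongrLeft (fun _ : Fin m => ℝ) σ⁻¹).measurableEmbedding f (SigmaN m)
    rw [hcomp] at this
    simpa only [hsymm] using this
  have hdisj : Pairwise (Function.onFun Disjoint S) := by
    intro σ τ hne
    exact Set.disjoint_left.2 fun x hσ hτ => hne (perm_eq_of_comp_mem_SigmaN hσ hτ)
  calc (m.factorial : ℝ) * ∫ x in SigmaN m, f x = ∑ σ, ∫ x in S σ, f x := by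
        simp [hSint, Fintype.card_perm]
    _ = ∫ x in ⋃ σ, S σ, f x :=
        (integral_iUnion_fintype hSm hdisj fun σ => hf.mono_set (hSsub σ)).symm
    _ ≤ _ := setIntegral_mono_set hf (Filter.Eventually.of_forall hf0)
        (Set.iUnion_subset hSsub).eventuallyLE

theorem setIntegral_SigmaN_laguerreDensity_le (N c : ℕ) {β : ℝ} (hβ : 0 < β) :
    ∫ x in SigmaN N, laguerreDensity N c β x ≤ ∏ i ∈ Finset.range N, laguerreNorm c β i := by
  obtain ⟨hint, hval⟩ := integrable_and_integral_laguerreDensity N c hβ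
  have h := factorial_mul_setIntegral_SigmaN_le (laguerreDensity_nonneg N c β)
    (laguerreDensity_comp_perm N c β) hint
  rw [hval] at h
  exact le_of_mul_le_mul_left h (by positivity)

theorem VdM_add (k p : ℕ) (x : Fin (k + p) → ℝ) :
    VdM (k + p) x = VdM k (fun i => x (Fin.castAdd p i)) *
      (∏ i : Fin k, ∏ j : Fin p, (x (Fin.castAdd p i) ^ 2 - x (Fin.natAdd k j) ^ 2)) *
      VdM p (fun j => x (Fin.natAdd k j)) := by
  have hlt (i : Fin k) (j : Fin p) : Fin.castAdd p i < Fin.natAdd k j := by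
    simp only [Fin.lt_def, Fin.val_castAdd, Fin.val_natAdd]
    omega
  have hcc (i j : Fin k) : Fin.castAdd p i < Fin.castAdd p j ↔ i < j :=
    (Fin.strictMono_castAdd p).lt_iff_lt
  have hnn (i j : Fin p) : Fin.natAdd k i < Fin.natAdd k j ↔ i < j :=
    (Fin.strictMono_natAdd k).lt_iff_lt
  simp only [VdM, Finset.prod_filter, Fintype.prod_prod_type, Fin.prod_univ_add, hcc, hnn, hlt,
    fun i j => (hlt i j).not_gt, if_true, if_false, Finset.prod_const_one,
    Finset.prod_mul_distrib]
  ring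

theorem VdM_sq_add_le {k p : ℕ} {x : Fin (k + p) → ℝ} (hx : x ∈ SigmaN (k + p)) :
    VdM (k + p) x ^ 2 ≤ (VdM k (fun i => x (Fin.castAdd p i)) ^ 2 *
      ∏ i : Fin k, x (Fin.castAdd p i) ^ (2 * (2 * p))) *
      VdM p (fun j => x (Fin.natAdd k j)) ^ 2 := by
  rw [VdM_add, mul_pow, mul_pow]
  gcongr
  rw [← Finset.prod_pow]
  refine Finset.prod_le_prod (fun i _ => by positivity) fun i _ => ?_
  rw [← Finset.prod_pow]
  calc ∏ j : Fin p, (x (Fin.castAdd p i) ^ 2 - x (Fin.natAdd k j) ^ 2) ^ 2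
      ≤ ∏ _j : Fin p, (x (Fin.castAdd p i) ^ 2) ^ 2 := by
        refine Finset.prod_le_prod (fun j _ => by positivity) fun j _ => ?_
        have h1 : x (Fin.natAdd k j) < x (Fin.castAdd p i) := hx.1 _ _ (by
          simp only [Fin.lt_def, Fin.val_castAdd, Fin.val_natAdd]
          omega)
        have h2 := hx.2 (Fin.natAdd k j)
        have h3 : x (Fin.natAdd k j) ^ 2 ≤ x (Fin.castAdd p i) ^ 2 := by gcongr
        have h4 : 0 ≤ x (Fin.natAdd k j) ^ 2 := by positivity
        exact pow_le_pow_left₀ (by linarith) (by linarith) 2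
    _ = x (Fin.castAdd p i) ^ (2 * (2 * p)) := by
        rw [Finset.prod_const, Finset.card_univ, Fintype.card_fin]
        ring

theorem exp_block_sum (k p : ℕ) (a b : ℝ) (x : Fin (k + p) → ℝ) :
    Real.exp (a * ∑ j ∈ Finset.univ.filter (fun j : Fin (k + p) => (j : ℕ) < k), x j ^ 2
        + b * ∑ j ∈ Finset.univ.filter (fun j : Fin (k + p) => k ≤ (j : ℕ)), x j ^ 2
        - (∑ j, x j ^ 2) / 2) =
      (∏ i : Fin k, Real.exp (-((1 - 2 * a) / 2) * x (Fin.castAdd p i) ^ 2)) *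
      ∏ j : Fin p, Real.exp (-((1 - 2 * b) / 2) * x (Fin.natAdd k j) ^ 2) := by
  rw [← Real.exp_sum, ← Real.exp_sum, ← Real.exp_add, ← Finset.mul_sum, ← Finset.mul_sum]
  congr 1
  simp only [Finset.sum_filter, Fin.sum_univ_add, Fin.val_castAdd, Fin.val_natAdd, Fin.is_lt,
    if_true, fun i : Fin k => i.is_lt.not_ge, if_false, Nat.le_add_right,
    fun i : Fin p => (Nat.le_add_right k i).not_gt, Finset.sum_const_zero]
  ring

theorem mem_SigmaN_castAdd {k p : ℕ} {x : Fin (k + p) → ℝ} (hx : x ∈ SigmaN (k + p)) :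
    (fun i => x (Fin.castAdd p i)) ∈ SigmaN k :=
  ⟨fun _ _ h => hx.1 _ _ (Fin.strictMono_castAdd p h), fun _ => hx.2 _⟩

theorem mem_SigmaN_natAdd {k p : ℕ} {x : Fin (k + p) → ℝ} (hx : x ∈ SigmaN (k + p)) :
    (fun j => x (Fin.natAdd k j)) ∈ SigmaN p :=
  ⟨fun _ _ h => hx.1 _ _ (Fin.strictMono_natAdd k h), fun _ => hx.2 _⟩

theorem exists_measurePreserving_block_split (k p : ℕ) :
    ∃ e : (Fin (k + p) → ℝ) ≃ᵐ (Fin k → ℝ) × (Fin p → ℝ), MeasurePreserving e ∧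
      ∀ x, e x = (fun i => x (Fin.castAdd p i), fun j => x (Fin.natAdd k j)) := by
  refine ⟨(MeasurableEquiv.piCongrLeft (fun _ => ℝ) finSumFinEquiv.symm).trans
    (MeasurableEquiv.sumPiEquivProdPi fun _ => ℝ),
    (volume_measurePreserving_piCongrLeft (fun _ => ℝ) finSumFinEquiv.symm).trans
      (volume_measurePreserving_sumPiEquivProdPi fun _ => ℝ), fun x => ?_⟩
  have h (s : Fin k ⊕ Fin p) :
      MeasurableEquiv.piCongrLeft (fun _ => ℝ) finSumFinEquiv.symm x s = x (finSumFinEquiv s) := by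
    simpa using MeasurableEquiv.piCongrLeft_apply_apply (finSumFinEquiv.symm)
      (β := fun _ => ℝ) x (finSumFinEquiv s)
  ext i
  · exact h (.inl i)
  · exact h (.inr i)

theorem setIntegral_SigmaN_add_le (k p : ℕ) {a b : ℝ} (ha : a < 1 / 2) (hb : b < 1 / 2) :
    ∫ x in SigmaN (k + p), VdM (k + p) x ^ 2 *
        Real.exp (a * ∑ j ∈ Finset.univ.filter (fun j : Fin (k + p) => (j : ℕ) < k), x j ^ 2
          + b * ∑ j ∈ Finset.univ.filter (fun j : Fin (k + p) => k ≤ (j : ℕ)), x j ^ 2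
          - (∑ j, x j ^ 2) / 2) ≤
      (∏ i ∈ Finset.range k, laguerreNorm (2 * p) ((1 - 2 * a) / 2) i) *
        ∏ i ∈ Finset.range p, laguerreNorm 0 ((1 - 2 * b) / 2) i := by
  obtain ⟨e, he, he'⟩ := exists_measurePreserving_block_split k p
  have hα : 0 < (1 - 2 * a) / 2 := by linarith
  have hβ : 0 < (1 - 2 * b) / 2 := by linarith
  set F := laguerreDensity k (2 * p) ((1 - 2 * a) / 2) with hF
  set G := laguerreDensity p 0 ((1 - 2 * b) / 2) with hG
  have hF0 (y) : 0 ≤ F y := laguerreDensity_nonneg _ _ _ y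
  have hG0 (z) : 0 ≤ G z := laguerreDensity_nonneg _ _ _ z
  have hFi : IntegrableOn F (SigmaN k) :=
    (integrable_and_integral_laguerreDensity k (2 * p) hα).1.mono_set (SigmaN_subset_pi k)
  have hGi : IntegrableOn G (SigmaN p) :=
    (integrable_and_integral_laguerreDensity p 0 hβ).1.mono_set (SigmaN_subset_pi p)
  have hprod : IntegrableOn (fun w : (Fin k → ℝ) × (Fin p → ℝ) => F w.1 * G w.2)
      (SigmaN k ×ˢ SigmaN p) := by
    rw [IntegrableOn, Measure.volume_eq_prod, ← Measure.prod_restrict]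
    exact hFi.mul_prod hGi
  have hpre : IntegrableOn (fun x => F (e x).1 * G (e x).2) (e ⁻¹' (SigmaN k ×ˢ SigmaN p)) :=
    (he.integrableOn_comp_preimage e.measurableEmbedding).2 hprod
  have hsub : SigmaN (k + p) ⊆ e ⁻¹' (SigmaN k ×ˢ SigmaN p) := fun x hx => by
    rw [Set.mem_preimage, he']
    exact ⟨mem_SigmaN_castAdd hx, mem_SigmaN_natAdd hx⟩
  calc _ ≤ ∫ x in SigmaN (k + p), F (e x).1 * G (e x).2 := by
        refine integral_mono_of_nonneg (Filter.Eventually.of_forall fun x => by positivity)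
          (hpre.mono_set hsub) ((ae_restrict_iff' (measurableSet_SigmaN _)).2
            (Filter.Eventually.of_forall fun x hx => ?_))
        simp only [he', hF, hG, laguerreDensity, exp_block_sum, Finset.prod_mul_distrib, mul_zero,
          pow_zero, one_mul]
        have h := mul_le_mul_of_nonneg_right (VdM_sq_add_le hx)
          (mul_nonneg (Finset.prod_nonneg fun (i : Fin k) (_ : i ∈ Finset.univ) => (Real.exp_pos
            (-((1 - 2 * a) / 2) * x (Fin.castAdd p i) ^ 2)).le)
            (Finset.prod_nonneg fun (j : Fin p) (_ : j ∈ Finset.univ) => (Real.exp_pos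
            (-((1 - 2 * b) / 2) * x (Fin.natAdd k j) ^ 2)).le))
        refine h.trans_eq ?_
        ring
    _ ≤ ∫ x in e ⁻¹' (SigmaN k ×ˢ SigmaN p), F (e x).1 * G (e x).2 :=
        setIntegral_mono_set hpre (Filter.Eventually.of_forall fun x => mul_nonneg (hF0 _) (hG0 _))
          hsub.eventuallyLE
    _ = ∫ w in SigmaN k ×ˢ SigmaN p, F w.1 * G w.2 :=
        he.setIntegral_preimage_emb e.measurableEmbedding (fun w => F w.1 * G w.2) _
    _ = (∫ y in SigmaN k, F y) * ∫ z in SigmaN p, G z := by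
        rw [Measure.volume_eq_prod]
        exact setIntegral_prod_mul F G _ _
    _ ≤ _ := by
        have h1 := setIntegral_SigmaN_laguerreDensity_le k (2 * p) hα
        have h2 := setIntegral_SigmaN_laguerreDensity_le p 0 hβ
        exact mul_le_mul h1 h2 (integral_nonneg hG0) ((integral_nonneg hF0).trans h1)

/-- The Laguerre norms, with the Gamma values at half-integers made explicit. -/
theorem laguerreNorm_half {s : ℝ} (hs : 0 < s) (c i : ℕ) :
    laguerreNorm c (s / 2) i = s ^ (-(c + 1 / 2 + 2 * i : ℝ)) * √(Real.pi / 2) *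
      (i.factorial * (2 * (c + i)).factorial / ((c + i).factorial * 2 ^ c)) := by
  have hΓ := Gamma_nat_add_half_mul (c + i)
  have hΓ' : Real.Gamma (c + 1 / 2 + i) =
      (2 * (c + i)).factorial * √Real.pi / (4 ^ (c + i) * (c + i).factorial) := by
    rw [eq_div_iff (by positivity), ← hΓ]
    push_cast
    ring_nf
  have h2 : (2 : ℝ) ^ (c + 1 / 2 + 2 * i : ℝ) = 2 ^ c * √2 * 4 ^ i := by
    rw [Real.rpow_add two_pos, Real.rpow_add two_pos, Real.rpow_natCast, ← Real.sqrt_eq_rpow,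
      Real.rpow_mul two_pos.le, Real.rpow_natCast]
    norm_num
  have h22 : √2 * √2 = (2 : ℝ) := Real.mul_self_sqrt two_pos.le
  rw [laguerreNorm, hΓ', Real.div_rpow hs.le two_pos.le, Real.rpow_neg two_pos.le, h2,
    Real.sqrt_div Real.pi_pos.le, pow_add, show (4 : ℝ) ^ c = 2 ^ c * 2 ^ c by
      rw [← mul_pow]; norm_num]
  field_simp
  linear_combination h22

theorem factorial_mul_div_le {p k i : ℕ} (hi : i < k) :
    (i.factorial * (2 * (2 * p + i)).factorial / ((2 * p + i).factorial * 2 ^ (2 * p)) : ℝ) ≤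
      2 ^ (2 * (k + p)) * (2 * (p + i)).factorial := by
  rw [div_le_iff₀ (by positivity)]
  have h1 : (2 * (2 * p + i)).factorial ≤
      2 ^ (2 * (2 * p + i)) * ((2 * p + i).factorial * (2 * p + i).factorial) := by
    rw [← Nat.choose_mul_factorial_mul_factorial (show 2 * p + i ≤ 2 * (2 * p + i) by omega),
      show 2 * (2 * p + i) - (2 * p + i) = 2 * p + i by omega, mul_assoc]
    gcongr
    exact Nat.choose_le_two_pow _ _
  have h2 : i.factorial * (2 * p + i).factorial ≤ (2 * (p + i)).factorial := by
    have := Nat.factorial_mul_factorial_dvd_factorial_add i (2 * p + i)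
    rw [show i + (2 * p + i) = 2 * (p + i) by ring] at this
    exact Nat.le_of_dvd (Nat.factorial_pos _) this
  have h3 : 2 ^ (2 * (2 * p + i)) ≤ 2 ^ (2 * (k + p)) * 2 ^ (2 * p) := by
    rw [← pow_add]
    exact Nat.pow_le_pow_right two_pos (by omega)
  have h : i.factorial * (2 * (2 * p + i)).factorial ≤
      2 ^ (2 * (k + p)) * (2 * (p + i)).factorial * ((2 * p + i).factorial * 2 ^ (2 * p)) :=
    calc _ ≤ i.factorial *
          (2 ^ (2 * (2 * p + i)) * ((2 * p + i).factorial * (2 * p + i).factorial)) := by gcongr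
      _ = 2 ^ (2 * (2 * p + i)) * (i.factorial * (2 * p + i).factorial) *
          (2 * p + i).factorial := by ring
      _ ≤ (2 ^ (2 * (k + p)) * 2 ^ (2 * p)) * (2 * (p + i)).factorial *
          (2 * p + i).factorial := by gcongr
      _ = _ := by ring
  exact_mod_cast h

theorem prod_rpow_arith {s : ℝ} (hs : 0 < s) (c N : ℕ) :
    ∏ i ∈ Finset.range N, s ^ (-(c + 1 / 2 + 2 * i : ℝ)) = s ^ (-(N * (c + N - 1 / 2) : ℝ)) := by
  induction N with
  | zero => simp
  | succ N ih =>
    rw [Finset.prod_range_succ, ih, ← Real.rpow_add hs]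
    congr 1
    push_cast
    ring

theorem prod_laguerreNorm_le (k p : ℕ) {s t : ℝ} (hs : 0 < s) (ht : 0 < t) :
    (∏ i ∈ Finset.range k, laguerreNorm (2 * p) (s / 2) i) *
        ∏ i ∈ Finset.range p, laguerreNorm 0 (t / 2) i ≤
      Zn (2 * (k + p)) * 2 ^ (2 * (k + p) * k) * s ^ (-(k * (2 * p + k - 1 / 2) : ℝ)) *
        t ^ (-(p * (p - 1 / 2) : ℝ)) := by
  have hZ : Zn (2 * (k + p)) = √(Real.pi / 2) ^ (k + p) *
      ((∏ i ∈ Finset.range p, ((2 * i).factorial : ℝ)) *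
        ∏ i ∈ Finset.range k, ((2 * (p + i)).factorial : ℝ)) := by
    rw [Zn, ← Finset.prod_range_add, Nat.mul_div_cancel_left _ two_pos, add_comm p k,
      Real.sqrt_eq_rpow, ← Real.rpow_natCast, ← Real.rpow_mul (by positivity)]
    congr 2
    push_cast
    ring
  have h2 : ∏ i ∈ Finset.range p, laguerreNorm 0 (t / 2) i = t ^ (-(p * (p - 1 / 2) : ℝ)) *
      √(Real.pi / 2) ^ p * ∏ i ∈ Finset.range p, ((2 * i).factorial : ℝ) := by
    simp only [laguerreNorm_half ht, Finset.prod_mul_distrib, prod_rpow_arith ht, Finset.prod_const,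
      Finset.card_range]
    simp only [Nat.cast_zero, zero_add, pow_zero, mul_one]
    congr 1
    refine Finset.prod_congr rfl fun i _ => ?_
    field_simp
  have h1 : ∏ i ∈ Finset.range k, laguerreNorm (2 * p) (s / 2) i ≤
      s ^ (-(k * (2 * p + k - 1 / 2) : ℝ)) * √(Real.pi / 2) ^ k *
        (2 ^ (2 * (k + p) * k) * ∏ i ∈ Finset.range k, ((2 * (p + i)).factorial : ℝ)) := by
    simp only [laguerreNorm_half hs, Finset.prod_mul_distrib, prod_rpow_arith hs, Finset.prod_const,
      Finset.card_range]
    push_cast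
    gcongr
    have hpow : (2 : ℝ) ^ (2 * (k + p) * k) = ∏ _i ∈ Finset.range k, 2 ^ (2 * (k + p)) := by
      rw [Finset.prod_const, Finset.card_range, pow_mul]
    rw [hpow, ← Finset.prod_mul_distrib]
    exact Finset.prod_le_prod (fun i _ => by positivity) fun i hi =>
      factorial_mul_div_le (Finset.mem_range.1 hi)
  rw [h2, hZ]
  refine (mul_le_mul_of_nonneg_right h1 (by positivity)).trans_eq ?_
  ring

theorem stmt5 (n : ℕ) (hn : Even n) (hpos : 0 < n) (k : ℕ) (hk : k ≤ n / 2)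
    (a b : ℝ) (ha : a < 1 / 2) (hb : b < 1 / 2) :
    ∫ μ in SigmaN (n / 2),
        (VdM (n / 2) μ) ^ 2 *
          Real.exp (a * ∑ j ∈ Finset.univ.filter (fun j : Fin (n / 2) => (j : ℕ) < k), μ j ^ 2
            + b * ∑ j ∈ Finset.univ.filter (fun j : Fin (n / 2) => k ≤ (j : ℕ)), μ j ^ 2
            - (∑ j, μ j ^ 2) / 2)
      ≤ Zn n * 2 ^ (n * k) * (1 - 2 * a) ^ (-((k : ℝ) * ((n : ℝ) - k - 1 / 2)))
          * (1 - 2 * b) ^ (-(((n : ℝ) / 2 - k) * (((n : ℝ) - 1) / 2 - k))) := by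
  obtain ⟨m, rfl⟩ := hn.two_dvd
  have hm : 2 * m / 2 = m := Nat.mul_div_cancel_left _ two_pos
  rw [hm] at hk
  obtain ⟨p, rfl⟩ := Nat.exists_eq_add_of_le hk
  rw [hm]
  refine (setIntegral_SigmaN_add_le k p ha hb).trans
    ((prod_laguerreNorm_le k p (by linarith) (by linarith)).trans_eq ?_)
  congr 3 <;> push_cast <;> ring
end
end

section
/- For every positive even integer n, ∫_{Σ_n} |Δ(μ)|² e^{μ_1²/4 − Σ_{j=1}^{n/2} μ_j²/2} dμ ≤ 2^{2n} Z_n. -/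
open MeasureTheory

noncomputable section

open Polynomial in
/-- Integral of a real polynomial against the weight `exp (-b x²)`. -/
def gaussInt (b : ℝ) (p : ℝ[X]) : ℝ := ∫ x : ℝ, p.eval x * Real.exp (-b * x ^ 2)

/-- The probabilists' Hermite polynomials with real coefficients. -/
def hermiteReal (n : ℕ) : Polynomial ℝ := (Polynomial.hermite n).map (Int.castRingHom ℝ)

namespace GaussHermite

open Polynomial

lemma integrable_eval_mul_exp {b : ℝ} (hb : 0 < b) (p : ℝ[X]) :
    Integrable fun x : ℝ => p.eval x * Real.exp (-b * x ^ 2) := by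
  induction p using Polynomial.induction_on' with
  | add p q hp hq =>
    simp only [eval_add, add_mul]
    exact hp.add hq
  | monomial n a =>
    have h := integrable_rpow_mul_exp_neg_mul_sq hb (s := n) (by
      have : (0 : ℝ) ≤ n := n.cast_nonneg
      linarith)
    simpa [mul_assoc] using h.const_mul a

lemma gaussInt_add {b : ℝ} (hb : 0 < b) (p q : ℝ[X]) :
    gaussInt b (p + q) = gaussInt b p + gaussInt b q := by
  simp only [gaussInt, eval_add, add_mul]
  exact integral_add (integrable_eval_mul_exp hb p) (integrable_eval_mul_exp hb q)

lemma gaussInt_C_mul (b a : ℝ) (p : ℝ[X]) : gaussInt b (C a * p) = a * gaussInt b p := by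
  simp only [gaussInt, eval_mul, eval_C, mul_assoc]
  exact integral_const_mul _ _

lemma gaussInt_sub {b : ℝ} (hb : 0 < b) (p q : ℝ[X]) :
    gaussInt b (p - q) = gaussInt b p - gaussInt b q := by
  simp only [gaussInt, eval_sub, sub_mul]
  exact integral_sub (integrable_eval_mul_exp hb p) (integrable_eval_mul_exp hb q)

lemma gaussInt_one (b : ℝ) : gaussInt b 1 = √(Real.pi / b) := by
  simpa [gaussInt] using integral_gaussian b

lemma gaussInt_nonneg {b : ℝ} {p : ℝ[X]} (hp : ∀ x, 0 ≤ p.eval x) : 0 ≤ gaussInt b p :=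
  integral_nonneg fun x => mul_nonneg (hp x) (Real.exp_pos _).le

lemma gaussInt_derivative {b : ℝ} (hb : 0 < b) (p : ℝ[X]) :
    gaussInt b (derivative p) = 2 * b * gaussInt b (X * p) := by
  have h : gaussInt b (derivative p - C (2 * b) * (X * p)) = 0 := by
    refine integral_eq_zero_of_hasDerivAt_of_integrable (fun x => ?_)
      (integrable_eval_mul_exp hb _) (integrable_eval_mul_exp hb p)
    have he : HasDerivAt (fun x : ℝ => Real.exp (-b * x ^ 2))
        (Real.exp (-b * x ^ 2) * (-b * (2 * x))) x := by
      simpa using (((hasDerivAt_id x).pow 2).const_mul (-b)).exp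
    refine ((p.hasDerivAt x).mul he).congr_deriv ?_
    simp only [eval_sub, eval_mul, eval_C, eval_X]
    ring
  rw [gaussInt_sub hb, gaussInt_C_mul] at h
  linarith

@[simp] lemma hermiteReal_zero : hermiteReal 0 = 1 := by simp [hermiteReal]

lemma hermiteReal_succ (n : ℕ) :
    hermiteReal (n + 1) = X * hermiteReal n - derivative (hermiteReal n) := by
  simp [hermiteReal, hermite_succ, derivative_map]

lemma derivative_hermiteReal_succ (n : ℕ) :
    derivative (hermiteReal (n + 1)) = C (n + 1 : ℝ) * hermiteReal n := by
  induction n with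
  | zero => simp [hermiteReal_succ]
  | succ n ih =>
    rw [hermiteReal_succ (n + 1), derivative_sub, derivative_mul, ih, derivative_C_mul,
      hermiteReal_succ n]
    simp
    ring

lemma gaussInt_half_hermite_succ_mul (n : ℕ) (f : ℝ[X]) :
    gaussInt (1 / 2) (hermiteReal (n + 1) * f) =
      gaussInt (1 / 2) (hermiteReal n * derivative f) := by
  have h := gaussInt_derivative (b := 1 / 2) (by norm_num) (hermiteReal n * f)
  rw [derivative_mul, gaussInt_add (by norm_num)] at h
  rw [hermiteReal_succ, sub_mul, gaussInt_sub (by norm_num), mul_assoc]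
  linarith

lemma gaussInt_half_hermite_mul_hermite (n k : ℕ) :
    gaussInt (1 / 2) (hermiteReal n * hermiteReal k) =
      if n = k then (n.factorial : ℝ) * √(2 * Real.pi) else 0 := by
  induction n generalizing k with
  | zero =>
    cases k with
    | zero => simp [gaussInt_one, mul_comm]
    | succ k =>
      rw [mul_comm, gaussInt_half_hermite_succ_mul]
      simp [gaussInt]
  | succ n ih =>
    cases k with
    | zero =>
      rw [gaussInt_half_hermite_succ_mul]
      simp [gaussInt]
    | succ k =>
      rw [gaussInt_half_hermite_succ_mul, derivative_hermiteReal_succ, mul_left_comm,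
        gaussInt_C_mul, ih]
      by_cases h : n = k
      · subst h
        simp [Nat.factorial_succ]
        ring
      · simp [h]

lemma gaussInt_quarter_hermite_succ_sq (n : ℕ) :
    gaussInt (1 / 4) (hermiteReal (n + 2) ^ 2) ≤
      12 / 5 * (n + 2) * gaussInt (1 / 4) (hermiteReal (n + 1) ^ 2) +
      9 / 5 * ((n + 1) * (n + 2)) * gaussInt (1 / 4) (hermiteReal n ^ 2) := by
  have hb : (0 : ℝ) < 1 / 4 := by norm_num
  set P := hermiteReal n
  set Q := hermiteReal (n + 1)
  set R := hermiteReal (n + 2)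
  have hQ' : derivative Q = C (n + 1 : ℝ) * P := derivative_hermiteReal_succ n
  have hR' : derivative R = C (n + 2 : ℝ) * Q := by
    have := derivative_hermiteReal_succ (n + 1)
    push_cast at this
    rw [show ((n : ℝ) + 1 + 1) = n + 2 by ring] at this
    exact this
  have hR : R = X * Q - derivative Q := hermiteReal_succ (n + 1)
  have h1 := gaussInt_derivative hb (Q * R)
  rw [derivative_mul, gaussInt_add hb, hQ', hR',
    show C (n + 1 : ℝ) * P * R = C (n + 1 : ℝ) * (P * R) by ring,
    show Q * (C (n + 2 : ℝ) * Q) = C (n + 2 : ℝ) * Q ^ 2 by ring,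
    gaussInt_C_mul, gaussInt_C_mul] at h1
  have h2 : gaussInt (1 / 4) (R ^ 2) =
      gaussInt (1 / 4) (X * (Q * R)) - (n + 1) * gaussInt (1 / 4) (P * R) := by
    rw [← gaussInt_C_mul, ← gaussInt_sub hb]
    congr 1
    rw [sq]
    nth_rewrite 1 [hR]
    rw [hQ']
    ring
  have h3 : 0 ≤ gaussInt (1 / 4) ((R - C (3 * (n + 2) : ℝ) * P) ^ 2) :=
    gaussInt_nonneg fun x => by simpa using sq_nonneg _
  rw [show (R - C (3 * (n + 2) : ℝ) * P) ^ 2 = R ^ 2 - C (6 * (n + 2) : ℝ) * (P * R) +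
      C ((3 * (n + 2)) ^ 2 : ℝ) * P ^ 2 by
      simp only [map_mul, map_pow, map_add, map_natCast, map_ofNat]; ring,
    gaussInt_add hb, gaussInt_sub hb, gaussInt_C_mul, gaussInt_C_mul] at h3
  have hn : (0 : ℝ) ≤ n := n.cast_nonneg
  have hA : 0 ≤ gaussInt (1 / 4) (R ^ 2) := gaussInt_nonneg fun x => by simpa using sq_nonneg _
  have h4 : (n + 1) * gaussInt (1 / 4) (P * R) ≤
      gaussInt (1 / 4) (R ^ 2) / 6 +
        3 / 2 * ((n + 1) * (n + 2)) * gaussInt (1 / 4) (P ^ 2) := by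
    have h5 : gaussInt (1 / 4) (P * R) ≤ gaussInt (1 / 4) (R ^ 2) / (6 * (n + 2)) +
        3 / 2 * (n + 2) * gaussInt (1 / 4) (P ^ 2) := by
      rw [← sub_nonneg]
      have : gaussInt (1 / 4) (R ^ 2) / (6 * (n + 2)) +
        3 / 2 * (n + 2) * gaussInt (1 / 4) (P ^ 2) - gaussInt (1 / 4) (P * R) =
        (gaussInt (1 / 4) (R ^ 2) - 6 * (n + 2) * gaussInt (1 / 4) (P * R) +
          (3 * (n + 2)) ^ 2 * gaussInt (1 / 4) (P ^ 2)) / (6 * (n + 2)) := by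
        field_simp
        ring
      rw [this]
      positivity
    calc (n + 1) * gaussInt (1 / 4) (P * R)
        ≤ (n + 1) * (gaussInt (1 / 4) (R ^ 2) / (6 * (n + 2)) +
          3 / 2 * (n + 2) * gaussInt (1 / 4) (P ^ 2)) := by gcongr
      _ = gaussInt (1 / 4) (R ^ 2) / 6 * ((n + 1) / (n + 2)) +
          3 / 2 * ((n + 1) * (n + 2)) * gaussInt (1 / 4) (P ^ 2) := by
        field_simp
      _ ≤ _ := by
        gcongr
        refine mul_le_of_le_one_right (by positivity) ?_
        rw [div_le_one (by positivity)]
        linarith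
  linarith

lemma gaussInt_quarter_hermite_sq_le (n : ℕ) :
    gaussInt (1 / 4) (hermiteReal n ^ 2) ≤ 3 ^ n * n.factorial * √(4 * Real.pi) := by
  have hb : (0 : ℝ) < 1 / 4 := by norm_num
  have h0 : gaussInt (1 / 4) 1 = √(4 * Real.pi) := by
    rw [gaussInt_one]
    congr 1
    ring
  induction n using Nat.strong_induction_on with
  | _ n ih =>
    match n with
    | 0 =>
      rw [hermiteReal_zero, one_pow, h0, pow_zero, Nat.factorial_zero, Nat.cast_one, one_mul,
        one_mul]
    | 1 =>
      have h := gaussInt_derivative hb X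
      rw [derivative_X, h0, ← sq] at h
      have h1 : hermiteReal 1 = X := by simp [hermiteReal_succ]
      have := Real.sqrt_nonneg (4 * Real.pi)
      simp only [h1, Nat.factorial_one, Nat.cast_one]
      linarith
    | n + 2 =>
      refine (gaussInt_quarter_hermite_succ_sq n).trans ?_
      calc _ ≤ 12 / 5 * ((n : ℝ) + 2) * (3 ^ (n + 1) * (n + 1).factorial * √(4 * Real.pi)) +
            9 / 5 * (((n : ℝ) + 1) * (n + 2)) * (3 ^ n * n.factorial * √(4 * Real.pi)) := by
            gcongr
            · exact ih (n + 1) (by omega)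
            · exact ih n (by omega)
        _ = _ := by
          simp only [Nat.factorial_succ, Nat.cast_mul]
          push_cast
          ring

/-- The monic polynomial of degree `k` with `evenHermite k (x²) = He_{2k}(x)`. -/
def evenHermite (k : ℕ) : ℝ[X] := contract 2 (hermiteReal (2 * k))

lemma expand_evenHermite (k : ℕ) : expand ℝ 2 (evenHermite k) = hermiteReal (2 * k) := by
  ext n
  rw [coeff_expand two_pos, evenHermite, coeff_contract two_ne_zero]
  split_ifs with h
  · rw [Nat.div_mul_cancel h]
  · rw [hermiteReal, coeff_map, coeff_hermite_of_odd_add, map_zero]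
    exact (even_two_mul k).add_odd (Nat.not_even_iff_odd.mp fun h' => h h'.two_dvd)

lemma eval_evenHermite (k : ℕ) (x : ℝ) :
    (evenHermite k).eval (x ^ 2) = (hermiteReal (2 * k)).eval x := by
  rw [← expand_evenHermite, expand_eval]

lemma natDegree_evenHermite (k : ℕ) : (evenHermite k).natDegree = k := by
  have h := natDegree_expand 2 (evenHermite k)
  rw [expand_evenHermite, hermiteReal, (hermite_monic _).natDegree_map, natDegree_hermite] at h
  omega

lemma monic_evenHermite (k : ℕ) : (evenHermite k).Monic := by
  rw [← monic_expand_iff two_pos, expand_evenHermite]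
  exact (hermite_monic _).map _

/-- Half-line pairing of `He_{2j}` and `He_{2k}` for the weight `exp (-b x²)`. -/
def halfPairing (b : ℝ) (j k : ℕ) : ℝ :=
  ∫ x in Set.Ioi (0 : ℝ), (evenHermite j).eval (x ^ 2) * (evenHermite k).eval (x ^ 2) *
    Real.exp (-b * x ^ 2)

lemma integrableOn_halfPairing {b : ℝ} (hb : 0 < b) (j k : ℕ) :
    IntegrableOn (fun x : ℝ => (evenHermite j).eval (x ^ 2) * (evenHermite k).eval (x ^ 2) *
      Real.exp (-b * x ^ 2)) (Set.Ioi 0) := by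
  have h := integrable_eval_mul_exp hb (hermiteReal (2 * j) * hermiteReal (2 * k))
  simp only [eval_mul, ← eval_evenHermite] at h
  exact h.integrableOn

lemma two_mul_halfPairing (b : ℝ) (j k : ℕ) :
    2 * halfPairing b j k = gaussInt b (hermiteReal (2 * j) * hermiteReal (2 * k)) := by
  rw [halfPairing, ← integral_comp_abs]
  simp only [gaussInt, sq_abs, eval_mul, eval_evenHermite]

lemma sqrt_two_pi : √(2 * Real.pi) = 2 * √(Real.pi / 2) := by
  rw [show 2 * Real.pi = 2 ^ 2 * (Real.pi / 2) by ring, Real.sqrt_mul (by norm_num),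
    Real.sqrt_sq (by norm_num)]

lemma halfPairing_half (j k : ℕ) :
    halfPairing (1 / 2) j k =
      if j = k then ((2 * j).factorial : ℝ) * √(Real.pi / 2) else 0 := by
  have h := two_mul_halfPairing (1 / 2) j k
  rw [gaussInt_half_hermite_mul_hermite, sqrt_two_pi] at h
  by_cases hjk : j = k
  · simp only [hjk, if_true] at h ⊢
    linarith
  · have : 2 * j ≠ 2 * k := by omega
    simp only [hjk, this, if_false] at h ⊢
    linarith

lemma halfPairing_quarter_le (k : ℕ) :
    halfPairing (1 / 4) k k ≤ 2 * 9 ^ k * halfPairing (1 / 2) k k := by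
  have h := two_mul_halfPairing (1 / 4) k k
  have h2 := gaussInt_quarter_hermite_sq_le (2 * k)
  have h3 : √(4 * Real.pi) ≤ 2 * √(2 * Real.pi) := by
    rw [Real.sqrt_le_left (by positivity), mul_pow, Real.sq_sqrt (by positivity)]
    linarith [Real.pi_pos]
  rw [← sq] at h
  rw [halfPairing_half, if_pos rfl]
  have h4 : (3 : ℝ) ^ (2 * k) * (2 * k).factorial * √(4 * Real.pi) ≤
      9 ^ k * (2 * k).factorial * (2 * √(2 * Real.pi)) := by
    rw [pow_mul]
    norm_num only
    gcongr
  rw [sqrt_two_pi] at h4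
  linarith

lemma measurableSet_SigmaN (m : ℕ) : MeasurableSet (SigmaN m) := by
  simp only [SigmaN, Set.ofPred_and, Set.ofPred_forall]
  refine MeasurableSet.inter ?_ ?_
  · refine MeasurableSet.iInter fun i => MeasurableSet.iInter fun j => MeasurableSet.iInter fun _ =>
      measurableSet_lt (measurable_pi_apply j) (measurable_pi_apply i)
  · exact MeasurableSet.iInter fun i => measurableSet_lt measurable_const (measurable_pi_apply i)

lemma measurePreserving_comp_perm {m : ℕ} (σ : Equiv.Perm (Fin m)) :
    MeasurePreserving (fun x : Fin m → ℝ => x ∘ σ) volume volume ∧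
      MeasurableEmbedding (fun x : Fin m → ℝ => x ∘ σ) := by
  have h : (fun x : Fin m → ℝ => x ∘ σ) =
      MeasurableEquiv.piCongrLeft (fun _ : Fin m => ℝ) σ.symm := by
    funext x i
    have := MeasurableEquiv.piCongrLeft_apply_apply (β := fun _ : Fin m => ℝ) σ.symm x (σ i)
    simpa using this.symm
  rw [h]
  exact ⟨volume_measurePreserving_piCongrLeft _ _, MeasurableEquiv.measurableEmbedding _⟩

lemma perm_eq_of_comp_mem_SigmaN {m : ℕ} {x : Fin m → ℝ} {σ τ : Equiv.Perm (Fin m)}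
    (hσ : x ∘ σ ∈ SigmaN m) (hτ : x ∘ τ ∈ SigmaN m) : σ = τ := by
  have key : ∀ ρ : Equiv.Perm (Fin m), x ∘ ρ ∈ SigmaN m → StrictMono fun i => -x (ρ i) :=
    fun ρ h i j hij => neg_lt_neg (h.1 i j hij)
  have hrange : ∀ ρ : Equiv.Perm (Fin m),
      Set.range (fun i => -x (ρ i)) = Set.range fun i => -x i := fun ρ =>
    ρ.surjective.range_comp fun i => -x i
  have h := ((key σ hσ).range_inj (key τ hτ)).mp ((hrange σ).trans (hrange τ).symm)
  ext1 i
  have h1 : -x (σ (σ.symm (τ i))) = -x (σ i) := by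
    simpa using (congrFun h i).symm
  have h2 := (key σ hσ).injective h1
  exact (σ.symm_apply_eq.mp h2).symm

lemma factorial_mul_setIntegral_SigmaN_le {m : ℕ} {F : (Fin m → ℝ) → ℝ}
    (hF : IntegrableOn F (Set.univ.pi fun _ => Set.Ioi 0)) (hF0 : ∀ x, 0 ≤ F x)
    (hsymm : ∀ (σ : Equiv.Perm (Fin m)) x, F (x ∘ σ) = F x) :
    m.factorial * ∫ x in SigmaN m, F x ≤ ∫ x in Set.univ.pi fun _ => Set.Ioi 0, F x := by
  let A : Equiv.Perm (Fin m) → Set (Fin m → ℝ) := fun σ => (fun x => x ∘ σ) ⁻¹' SigmaN m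
  have hA : ∀ σ, MeasurableSet (A σ) := fun σ =>
    (measurePreserving_comp_perm σ).1.measurable (measurableSet_SigmaN m)
  have hsub : ∀ σ, A σ ⊆ Set.univ.pi fun _ => Set.Ioi 0 := fun σ x hx i _ => by
    simpa using hx.2 (σ.symm i)
  have hint : ∀ σ, ∫ x in A σ, F x = ∫ x in SigmaN m, F x := fun σ => by
    obtain ⟨hp, he⟩ := measurePreserving_comp_perm σ
    rw [← hp.setIntegral_preimage_emb he F (SigmaN m)]
    simp only [hsymm]
    rfl
  calc m.factorial * ∫ x in SigmaN m, F x
      = ∑ σ : Equiv.Perm (Fin m), ∫ x in A σ, F x := by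
        simp [hint, Fintype.card_perm]
    _ = ∫ x in ⋃ σ, A σ, F x := by
        refine (integral_iUnion_fintype hA ?_ fun σ => hF.mono_set (hsub σ)).symm
        intro σ τ hne
        exact Set.disjoint_left.mpr fun x h1 h2 => hne (perm_eq_of_comp_mem_SigmaN h1 h2)
    _ ≤ _ := setIntegral_mono_set hF (Filter.Eventually.of_forall hF0)
        (Set.iUnion_subset hsub).eventuallyLE

lemma VdM_sq (m : ℕ) (x : Fin m → ℝ) :
    VdM m x ^ 2 = (Matrix.vandermonde fun i => x i ^ 2).det ^ 2 := by
  have h : VdM m x = ∏ i : Fin m, ∏ j ∈ Finset.Ioi i, (x i ^ 2 - x j ^ 2) := by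
    rw [VdM, Finset.prod_filter, Fintype.prod_prod_type]
    refine Finset.prod_congr rfl fun i _ => ?_
    rw [← Finset.prod_filter]
    refine Finset.prod_congr ?_ fun _ _ => rfl
    ext j
    simp
  rw [h, Matrix.det_vandermonde]
  simp only [← Finset.prod_pow]
  exact Finset.prod_congr rfl fun i _ => Finset.prod_congr rfl fun j _ => by ring

lemma VdM_comp_perm_sq {m : ℕ} (σ : Equiv.Perm (Fin m)) (x : Fin m → ℝ) :
    VdM m (x ∘ σ) ^ 2 = VdM m x ^ 2 := by
  have h := Matrix.det_permute σ (Matrix.vandermonde fun i => x i ^ 2)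
  rw [VdM_sq, VdM_sq]
  have h' : (Matrix.vandermonde fun i => (x ∘ σ) i ^ 2) =
      (Matrix.vandermonde fun i => x i ^ 2).submatrix σ id := rfl
  rw [h', h, mul_pow]
  rcases Int.units_eq_one_or (Equiv.Perm.sign σ) with hs | hs <;> simp [hs]

lemma VdM_sq_eq_sum (m : ℕ) (x : Fin m → ℝ) :
    VdM m x ^ 2 = ∑ σ : Equiv.Perm (Fin m), ∑ τ : Equiv.Perm (Fin m),
      ((Equiv.Perm.sign σ : ℤ) : ℝ) * ((Equiv.Perm.sign τ : ℤ) : ℝ) *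
        ∏ i, ((evenHermite (σ i)).eval (x i ^ 2) * (evenHermite (τ i)).eval (x i ^ 2)) := by
  rw [VdM_sq, Matrix.det_eval_matrixOfPolynomials_eq_det_vandermonde _
    (fun k : Fin m => evenHermite k) (fun k => natDegree_evenHermite k)
    (fun k => monic_evenHermite k), ← Matrix.det_transpose, Matrix.det_apply', sq,
    Finset.sum_mul_sum]
  refine Finset.sum_congr rfl fun σ _ => Finset.sum_congr rfl fun τ _ => ?_
  simp only [Matrix.transpose_apply, Matrix.of_apply, Finset.prod_mul_distrib]
  ring

/-- Decay rate in the `j`-th coordinate after boosting the `i`-th one by `exp (x_i² / 4)`. -/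
def rate {m : ℕ} (i j : Fin m) : ℝ := if j = i then 1 / 4 else 1 / 2

lemma rate_pos {m : ℕ} (i j : Fin m) : 0 < rate i j := by
  unfold rate
  split_ifs <;> norm_num

lemma exp_eq_prod_rate {m : ℕ} (i : Fin m) (x : Fin m → ℝ) :
    Real.exp (x i ^ 2 / 4 - (∑ j, x j ^ 2) / 2) = ∏ j, Real.exp (-rate i j * x j ^ 2) := by
  rw [← Real.exp_sum]
  congr 1
  have h : ∀ j, -rate i j * x j ^ 2 = (if j = i then x j ^ 2 / 4 else 0) - x j ^ 2 / 2 := by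
    intro j
    unfold rate
    split_ifs <;> ring
  simp only [h, Finset.sum_sub_distrib, Finset.sum_ite_eq', Finset.mem_univ, if_true,
    Finset.sum_div]

/-- The boosted density expanded into products of one-variable functions. -/
lemma boosted_density_eq_sum {m : ℕ} (i : Fin m) (x : Fin m → ℝ) :
    VdM m x ^ 2 * Real.exp (x i ^ 2 / 4 - (∑ j, x j ^ 2) / 2) =
      ∑ σ : Equiv.Perm (Fin m), ∑ τ : Equiv.Perm (Fin m),
        ((Equiv.Perm.sign σ : ℤ) : ℝ) * ((Equiv.Perm.sign τ : ℤ) : ℝ) *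
          ∏ j, ((evenHermite (σ j)).eval (x j ^ 2) * (evenHermite (τ j)).eval (x j ^ 2) *
            Real.exp (-rate i j * x j ^ 2)) := by
  rw [VdM_sq_eq_sum, exp_eq_prod_rate, Finset.sum_mul]
  refine Finset.sum_congr rfl fun σ _ => ?_
  rw [Finset.sum_mul]
  refine Finset.sum_congr rfl fun τ _ => ?_
  rw [mul_assoc, ← Finset.prod_mul_distrib]

lemma volume_restrict_orthant (m : ℕ) :
    (volume : Measure (Fin m → ℝ)).restrict (Set.univ.pi fun _ => Set.Ioi 0) =
      Measure.pi fun _ => volume.restrict (Set.Ioi 0) :=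
  Measure.restrict_pi_pi _ _

lemma integrable_boosted_term {m : ℕ} (i : Fin m) (σ τ : Equiv.Perm (Fin m)) :
    Integrable (fun x : Fin m → ℝ =>
      ((Equiv.Perm.sign σ : ℤ) : ℝ) * ((Equiv.Perm.sign τ : ℤ) : ℝ) *
        ∏ j, ((evenHermite (σ j)).eval (x j ^ 2) * (evenHermite (τ j)).eval (x j ^ 2) *
          Real.exp (-rate i j * x j ^ 2))) (Measure.pi fun _ => volume.restrict (Set.Ioi 0)) :=
  (Integrable.fintype_prod (f := fun j (t : ℝ) => (evenHermite (σ j)).eval (t ^ 2) *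
    (evenHermite (τ j)).eval (t ^ 2) * Real.exp (-rate i j * t ^ 2))
    fun j => integrableOn_halfPairing (rate_pos i j) (σ j) (τ j)).const_mul _

lemma integrableOn_boosted_density {m : ℕ} (i : Fin m) :
    IntegrableOn (fun x : Fin m → ℝ =>
      VdM m x ^ 2 * Real.exp (x i ^ 2 / 4 - (∑ j, x j ^ 2) / 2))
      (Set.univ.pi fun _ => Set.Ioi 0) := by
  rw [IntegrableOn, volume_restrict_orthant]
  simp only [boosted_density_eq_sum]
  exact integrable_finsetSum _ fun σ _ => integrable_finsetSum _ fun τ _ =>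
    integrable_boosted_term i σ τ

/-- Two permutations agreeing away from one point are equal. -/
lemma perm_eq_of_forall_ne {m : ℕ} {i : Fin m} {σ τ : Equiv.Perm (Fin m)}
    (h : ∀ j, j ≠ i → σ j = τ j) : σ = τ := by
  ext1 j
  by_cases hj : j = i
  · subst hj
    by_contra hne
    have h1 : τ.symm (σ j) ≠ j := fun h' => hne (by rw [← τ.apply_symm_apply (σ j), h'])
    have h2 := h _ h1
    rw [τ.apply_symm_apply] at h2
    exact h1 (σ.injective h2)
  · exact h j hj

lemma setIntegral_boosted_density {m : ℕ} (i : Fin m) :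
    ∫ x in Set.univ.pi fun _ : Fin m => Set.Ioi (0 : ℝ),
      VdM m x ^ 2 * Real.exp (x i ^ 2 / 4 - (∑ j, x j ^ 2) / 2) =
      ∑ σ : Equiv.Perm (Fin m), ∏ j, halfPairing (rate i j) (σ j) (σ j) := by
  rw [volume_restrict_orthant]
  simp only [boosted_density_eq_sum]
  rw [integral_finsetSum _ fun σ _ => integrable_finsetSum _ fun τ _ =>
    integrable_boosted_term i σ τ]
  refine Finset.sum_congr rfl fun σ _ => ?_
  rw [integral_finsetSum _ fun τ _ => integrable_boosted_term i σ τ]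
  have hterm : ∀ τ : Equiv.Perm (Fin m), ∫ x : Fin m → ℝ,
      ((Equiv.Perm.sign σ : ℤ) : ℝ) * ((Equiv.Perm.sign τ : ℤ) : ℝ) *
        ∏ j, ((evenHermite (σ j)).eval (x j ^ 2) * (evenHermite (τ j)).eval (x j ^ 2) *
          Real.exp (-rate i j * x j ^ 2)) ∂(Measure.pi fun _ => volume.restrict (Set.Ioi 0)) =
      ((Equiv.Perm.sign σ : ℤ) : ℝ) * ((Equiv.Perm.sign τ : ℤ) : ℝ) *
        ∏ j, halfPairing (rate i j) (σ j) (τ j) := fun τ => by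
    rw [integral_const_mul]
    congr 1
    exact integral_fintype_prod_eq_prod (fun j (t : ℝ) => (evenHermite (σ j)).eval (t ^ 2) *
      (evenHermite (τ j)).eval (t ^ 2) * Real.exp (-rate i j * t ^ 2))
  simp only [hterm]
  rw [Finset.sum_eq_single σ]
  · rcases Int.units_eq_one_or (Equiv.Perm.sign σ) with hs | hs <;> simp [hs]
  · intro τ _ hne
    have hex : ∃ j, j ≠ i ∧ σ j ≠ τ j := by
      by_contra! hcon
      exact hne (perm_eq_of_forall_ne hcon).symm
    obtain ⟨j, hji, hj⟩ := hex
    rw [Finset.prod_eq_zero (Finset.mem_univ j), mul_zero]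
    rw [rate, if_neg hji, halfPairing_half, if_neg fun h => hj (Fin.ext h)]
  · simp

lemma halfPairing_self_nonneg (b : ℝ) (k : ℕ) : 0 ≤ halfPairing b k k :=
  integral_nonneg fun _ => mul_nonneg (mul_self_nonneg _) (Real.exp_pos _).le

lemma prod_halfPairing_le {m : ℕ} (i : Fin m) (σ : Equiv.Perm (Fin m)) :
    ∏ j, halfPairing (rate i j) (σ j) (σ j) ≤
      2 * 9 ^ (σ i : ℕ) * ∏ k : Fin m, halfPairing (1 / 2) k k := by
  rw [← Equiv.prod_comp σ (fun k : Fin m => halfPairing (1 / 2) k k),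
    ← Finset.mul_prod_erase _ _ (Finset.mem_univ i),
    ← Finset.mul_prod_erase _ (fun j => halfPairing (1 / 2) (σ j) (σ j)) (Finset.mem_univ i),
    ← mul_assoc]
  have h : ∏ j ∈ Finset.univ.erase i, halfPairing (rate i j) (σ j) (σ j) =
      ∏ j ∈ Finset.univ.erase i, halfPairing (1 / 2) (σ j) (σ j) :=
    Finset.prod_congr rfl fun j hj => by rw [rate, if_neg (Finset.ne_of_mem_erase hj)]
  rw [h, rate, if_pos rfl]
  exact mul_le_mul_of_nonneg_right (halfPairing_quarter_le _)
    (Finset.prod_nonneg fun j _ => halfPairing_self_nonneg _ _)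

lemma sum_two_mul_nine_pow_le (m : ℕ) : ∑ k : Fin m, (2 : ℝ) * 9 ^ (k : ℕ) ≤ 16 ^ m := by
  rw [Fin.sum_univ_eq_sum_range (fun k => (2 : ℝ) * 9 ^ k)]
  induction m with
  | zero => simp
  | succ m ih =>
    rw [Finset.sum_range_succ, pow_succ]
    have : (9 : ℝ) ^ m ≤ 16 ^ m := by gcongr; norm_num
    linarith [pow_nonneg (by norm_num : (0 : ℝ) ≤ 9) m]

lemma setIntegral_boosted_density_le {m : ℕ} (i₀ : Fin m) :
    ∫ x in SigmaN m, VdM m x ^ 2 * Real.exp (x i₀ ^ 2 / 4 - (∑ j, x j ^ 2) / 2) ≤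
      16 ^ m * ∏ k : Fin m, halfPairing (1 / 2) k k := by
  let f : Fin m → (Fin m → ℝ) → ℝ := fun i x =>
    VdM m x ^ 2 * Real.exp (x i ^ 2 / 4 - (∑ j, x j ^ 2) / 2)
  have hf0 : ∀ i x, 0 ≤ f i x := fun i x => by positivity
  have hsub : SigmaN m ⊆ Set.univ.pi fun _ => Set.Ioi 0 := fun x hx i _ => hx.2 i
  have hint : ∀ i, IntegrableOn (f i) (Set.univ.pi fun _ => Set.Ioi 0) :=
    integrableOn_boosted_density
  have hF : IntegrableOn (fun x => ∑ i, f i x) (Set.univ.pi fun _ => Set.Ioi 0) :=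
    integrable_finsetSum _ fun i _ => hint i
  have hP : 0 ≤ ∏ k : Fin m, halfPairing (1 / 2) k k :=
    Finset.prod_nonneg fun k _ => halfPairing_self_nonneg _ _
  have hle : ∫ x in SigmaN m, f i₀ x ≤ ∫ x in SigmaN m, ∑ i, f i x :=
    integral_mono ((hint i₀).mono_set hsub) (hF.mono_set hsub) fun x =>
      Finset.single_le_sum (f := fun i => f i x) (fun i _ => hf0 i x) (Finset.mem_univ i₀)
  refine hle.trans ?_
  have hsymm : ∀ (σ : Equiv.Perm (Fin m)) x, ∑ i, f i (x ∘ σ) = ∑ i, f i x := fun σ x => by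
    simp only [f, VdM_comp_perm_sq, Function.comp_apply]
    rw [Equiv.sum_comp σ (fun j => x j ^ 2)]
    exact Equiv.sum_comp σ fun i =>
      VdM m x ^ 2 * Real.exp (x i ^ 2 / 4 - (∑ j, x j ^ 2) / 2)
  have hfac : (0 : ℝ) < m.factorial := by positivity
  refine le_of_mul_le_mul_left ?_ hfac
  calc m.factorial * ∫ x in SigmaN m, ∑ i, f i x
      ≤ ∫ x in Set.univ.pi fun _ => Set.Ioi 0, ∑ i, f i x :=
        factorial_mul_setIntegral_SigmaN_le hF
          (fun x => Finset.sum_nonneg fun i _ => hf0 i x) hsymm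
    _ = ∑ i, ∑ σ : Equiv.Perm (Fin m), ∏ j, halfPairing (rate i j) (σ j) (σ j) := by
        rw [integral_finsetSum _ fun i _ => hint i]
        exact Finset.sum_congr rfl fun i _ => setIntegral_boosted_density i
    _ ≤ ∑ i, ∑ σ : Equiv.Perm (Fin m),
          2 * 9 ^ (σ i : ℕ) * ∏ k : Fin m, halfPairing (1 / 2) k k :=
        Finset.sum_le_sum fun i _ => Finset.sum_le_sum fun σ _ => prod_halfPairing_le i σ
    _ = m.factorial * ((∑ k : Fin m, (2 : ℝ) * 9 ^ (k : ℕ)) *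
          ∏ k : Fin m, halfPairing (1 / 2) k k) := by
        rw [Finset.sum_comm]
        simp only [← Finset.sum_mul]
        simp only [fun σ : Equiv.Perm (Fin m) =>
          Equiv.sum_comp σ (fun k : Fin m => (2 : ℝ) * 9 ^ (k : ℕ))]
        simp [Fintype.card_perm, mul_assoc]
    _ ≤ m.factorial * (16 ^ m * ∏ k : Fin m, halfPairing (1 / 2) k k) := by
        gcongr
        exact sum_two_mul_nine_pow_le m

lemma prod_halfPairing_eq_Zn (m : ℕ) :
    ∏ k : Fin m, halfPairing (1 / 2) k k = Zn (2 * m) := by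
  simp only [halfPairing_half, if_true]
  rw [Fin.prod_univ_eq_prod_range (fun k => ((2 * k).factorial : ℝ) * √(Real.pi / 2)),
    Finset.prod_mul_distrib, Finset.prod_const, Finset.card_range, Zn,
    Nat.mul_div_cancel_left _ two_pos, mul_comm, Real.sqrt_eq_rpow, ← Real.rpow_natCast,
    ← Real.rpow_mul (by positivity)]
  congr 2
  push_cast
  ring

end GaussHermite

theorem stmt6 (n : ℕ) (hn : Even n) (hpos : 0 < n) (hm : 0 < n / 2) :
    ∫ μ in SigmaN (n / 2),
        (VdM (n / 2) μ) ^ 2 *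
          Real.exp ((μ ⟨0, hm⟩) ^ 2 / 4 - (∑ j, μ j ^ 2) / 2)
      ≤ 2 ^ (2 * n) * Zn n := by
  obtain ⟨m, rfl⟩ := hn.two_dvd
  refine (GaussHermite.setIntegral_boosted_density_le ⟨0, hm⟩).trans_eq ?_
  rw [GaussHermite.prod_halfPairing_eq_Zn, Nat.mul_div_cancel_left _ two_pos, ← mul_assoc, pow_mul]
  norm_num
end
end
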